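/- Let ⟨A ∣ R⟩ be a presentation satisfying C'(1/6). If u is a nonempty reduced word in the free group F(A) that is majority-reduced, i.e. u contains no subword v such that v is a subword of some r ∈ R* with |v| > |r|/2, then u does not lie in the normal closure of R in F(A); equivalently, u represents a nontrivial element of the presented group ⟨A ∣ R⟩. -/

import Mathlib

variable {α : Type*} [DecidableEq α]

/-- A reduced word is *cyclically reduced* if all of its cyclic rotations are reduced. -/
def IsCyclicallyReduced (l : List (α × Bool)) : Prop :=
  ∀ i : ℕ, (FreeGroup.mk (l.rotate i)).toWord = l.rotate i

/-- The symmetrized closure `R*` of a set `R` of cyclically reduced relators: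
all elements whose reduced word is a cyclic permutation of the reduced word of
some `r ∈ R` or of its inverse. -/
def symClosure (R : Set (FreeGroup α)) : Set (FreeGroup α) :=
  {g | ∃ r ∈ R, ∃ i : ℕ,
    g.toWord = r.toWord.rotate i ∨ g.toWord = (r⁻¹).toWord.rotate i}

/-- A *piece* is a nonempty word occurring as a common prefix of two distinct
elements of the symmetrized closure `R*`. -/
def IsPiece (R : Set (FreeGroup α)) (p : List (α × Bool)) : Prop :=
  p ≠ [] ∧ ∃ r₁ ∈ symClosure R, ∃ r₂ ∈ symClosure R,
    r₁ ≠ r₂ ∧ p <+: r₁.toWord ∧ p <+: r₂.toWord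

/-- The presentation with relators `R` satisfies `C'(1/6)`: every piece `p` that is
a prefix of some `r ∈ R*` satisfies `|p| < |r|/6`. -/
def CPrimeSixth (R : Set (FreeGroup α)) : Prop :=
  ∀ p, IsPiece R p → ∀ r ∈ symClosure R, p <+: r.toWord →
    6 * p.length < r.toWord.length

/-! ### Counting classes of quotients -/

theorem quot_card_le {X : Type} [Finite X] {r r' : X → X → Prop}
    (h : ∀ a b, r a b → Quot.mk r' a = Quot.mk r' b) :
    Nat.card (Quot r') ≤ Nat.card (Quot r) := by
  refine Nat.card_le_card_of_surjective (Quot.lift (Quot.mk r') h) ?_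
  rintro ⟨a⟩
  exact ⟨Quot.mk r a, rfl⟩

theorem quot_card_lt {X : Type} [Finite X] {r r' : X → X → Prop}
    (h : ∀ a b, r a b → Quot.mk r' a = Quot.mk r' b) {x y : X}
    (h1 : Quot.mk r x ≠ Quot.mk r y) (h2 : Quot.mk r' x = Quot.mk r' y) :
    Nat.card (Quot r') + 1 ≤ Nat.card (Quot r) := by
  classical
  have := Fintype.ofFinite (Quot r)
  have := Fintype.ofFinite (Quot r')
  rw [Nat.card_eq_fintype_card, Nat.card_eq_fintype_card]
  refine Fintype.card_lt_of_surjective_not_injective (Quot.lift (Quot.mk r') h) ?_ ?_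
  · rintro ⟨a⟩
    exact ⟨Quot.mk r a, rfl⟩
  · intro hi
    exact h1 (hi h2)

theorem quot_card_le_succ {X : Type} [Finite X] {r r' : X → X → Prop} {x y : X}
    (h : ∀ a b, r a b → Quot.mk r' a = Quot.mk r' b ∨
      (Quot.mk r' a = Quot.mk r' x ∧ Quot.mk r' b = Quot.mk r' y) ∨
      (Quot.mk r' a = Quot.mk r' y ∧ Quot.mk r' b = Quot.mk r' x)) :
    Nat.card (Quot r') ≤ Nat.card (Quot r) + 1 := by
  classical
  let g : X → Quot r' := fun a => if Quot.mk r' a = Quot.mk r' y then Quot.mk r' x else Quot.mk r' a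
  have hg : ∀ a b, r a b → g a = g b := by
    intro a b hab
    simp only [g]
    rcases h a b hab with h | ⟨h1, h2⟩ | ⟨h1, h2⟩
    · rw [h]
    · rw [h1, h2]; simp
    · rw [h1, h2]; simp
  rw [← Finite.card_option]
  refine Nat.card_le_card_of_surjective
    (fun o : Option (Quot r) => o.elim (Quot.mk r' y) (Quot.lift g hg)) ?_
  rintro ⟨a⟩
  by_cases ha : Quot.mk r' a = Quot.mk r' y
  · exact ⟨none, ha.symm⟩
  · exact ⟨some (Quot.mk r a), by simp [g, ha]⟩

/-! ### Cycles of permutations -/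

/-- one step of a permutation -/
def pstep {X : Type} (π : Equiv.Perm X) : X → X → Prop := fun x y => y = π x

/-- number of cycles -/
noncomputable def ncyc {X : Type} (π : Equiv.Perm X) : ℕ := Nat.card (Quot (pstep π))

theorem pstep_mk {X : Type} (π : Equiv.Perm X) (x : X) :
    Quot.mk (pstep π) (π x) = Quot.mk (pstep π) x :=
  (Quot.sound (show pstep π x (π x) from rfl)).symm

theorem pstep_mk_pow {X : Type} (π : Equiv.Perm X) (x : X) (n : ℕ) :
    Quot.mk (pstep π) ((π ^ n) x) = Quot.mk (pstep π) x := by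
  induction n with
  | zero => rfl
  | succ n ih => rw [pow_succ', Equiv.Perm.mul_apply, pstep_mk, ih]

theorem pstep_exact {X : Type} [Finite X] (π : Equiv.Perm X) {x y : X}
    (h : Quot.mk (pstep π) x = Quot.mk (pstep π) y) : ∃ n, (π ^ n) x = y := by
  have h' := Quot.eqvGen_exact h
  have : π.SameCycle x y := by
    clear h
    induction h' with
    | rel a b h => cases h; exact ⟨1, by simp⟩
    | refl a => exact Equiv.Perm.SameCycle.refl _ _
    | symm a b _ ih => exact ih.symm
    | trans a b c h1 h2 ih1 ih2 =>
      exact ih1.trans ih2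
  obtain ⟨n, _, _, hn⟩ := this.exists_pow_eq''
  exact ⟨n, hn⟩

theorem ncyc_le_swap {X : Type} [Finite X] [DecidableEq X] (π : Equiv.Perm X) (x y : X) :
    ncyc π ≤ ncyc (Equiv.swap x y * π) + 1 := by
  refine quot_card_le_succ (x := x) (y := y) ?_
  rintro a b rfl
  simp only [Equiv.Perm.mul_apply]
  rw [← pstep_mk π a]
  by_cases h1 : π a = x
  · rw [h1]; simp
  by_cases h2 : π a = y
  · rw [h2]; simp
  rw [Equiv.swap_apply_of_ne_of_ne h1 h2]; simp

theorem pstep_swap_of_ne {X : Type} [Finite X] [DecidableEq X] (π : Equiv.Perm X) (x y : X)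
    (h : Quot.mk (pstep π) x ≠ Quot.mk (pstep π) y) :
    Quot.mk (pstep (Equiv.swap x y * π)) x = Quot.mk (pstep (Equiv.swap x y * π)) y := by
  classical
  have hex : ∃ k, 0 < k ∧ (π ^ k) x = x := ⟨orderOf π, orderOf_pos π, by simp [pow_orderOf_eq_one]⟩
  obtain ⟨hk0, hk⟩ := Nat.find_spec hex
  have hmin : ∀ j, 0 < j → j < Nat.find hex → (π ^ j) x ≠ x := fun j h0 hj hx =>
    Nat.find_min hex hj ⟨h0, hx⟩
  set k := Nat.find hex
  have hy : ∀ j, (π ^ j) x ≠ y := fun j hj => h (by rw [← hj, pstep_mk_pow])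
  have key : ∀ j, j < k → ((Equiv.swap x y * π) ^ j) x = (π ^ j) x := by
    intro j
    induction j with
    | zero => intro _; rfl
    | succ j ih =>
      intro hj
      rw [pow_succ', Equiv.Perm.mul_apply, ih (by omega), Equiv.Perm.mul_apply,
        ← Equiv.Perm.mul_apply π, ← pow_succ',
        Equiv.swap_apply_of_ne_of_ne (hmin _ (by omega) hj) (hy _)]
  have : ((Equiv.swap x y * π) ^ k) x = y := by
    obtain ⟨j, hj⟩ : ∃ j, k = j + 1 := ⟨k - 1, by omega⟩
    rw [hj, pow_succ', Equiv.Perm.mul_apply, key j (by omega), Equiv.Perm.mul_apply,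
        ← Equiv.Perm.mul_apply π, ← pow_succ', ← hj, hk, Equiv.swap_apply_left]
  have h2 := pstep_mk_pow (Equiv.swap x y * π) x k
  rw [this] at h2
  exact h2.symm

theorem ncyc_swap_of_eq {X : Type} [Finite X] [DecidableEq X] (π : Equiv.Perm X) (x y : X)
    (hxy : x ≠ y) (h : Quot.mk (pstep π) x = Quot.mk (pstep π) y) :
    ncyc π + 1 ≤ ncyc (Equiv.swap x y * π) := by
  classical
  obtain ⟨n, hn⟩ := pstep_exact π h
  have hex : ∃ k, (π ^ k) x = y := ⟨n, hn⟩
  have hk := Nat.find_spec hex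
  have hmin : ∀ j, j < Nat.find hex → (π ^ j) x ≠ y := fun j hj hx => Nat.find_min hex hj hx
  set k := Nat.find hex
  have hk0 : 0 < k := by
    rcases Nat.eq_zero_or_pos k with h0 | h0
    · rw [h0] at hk; exact absurd hk hxy
    · exact h0
  have hx : ∀ j, 0 < j → j < k → (π ^ j) x ≠ x := by
    intro j h0 hj hx
    apply hmin (k - j) (by omega)
    rw [← hk]
    conv_rhs => rw [show k = (k - j) + j by omega, pow_add, Equiv.Perm.mul_apply, hx]
  let S : Set X := {z | ∃ j, j < k ∧ (π ^ j) x = z}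
  have hS : ∀ z ∈ S, (Equiv.swap x y * π) z ∈ S := by
    rintro z ⟨j, hj, rfl⟩
    rw [Equiv.Perm.mul_apply, ← Equiv.Perm.mul_apply π, ← pow_succ']
    rcases Nat.lt_or_ge (j + 1) k with h1 | h1
    · rw [Equiv.swap_apply_of_ne_of_ne (hx _ (by omega) h1) (hmin _ h1)]
      exact ⟨j + 1, h1, rfl⟩
    · rw [show j + 1 = k by omega, hk, Equiv.swap_apply_right]
      exact ⟨0, hk0, rfl⟩
  refine quot_card_lt (x := x) (y := y) ?_ ?_ h
  · rintro a b rfl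
    simp only [Equiv.Perm.mul_apply]
    rw [← pstep_mk π a]
    by_cases h1 : π a = x
    · rw [h1]; simp [h]
    by_cases h2 : π a = y
    · rw [h2]; simp [h]
    rw [Equiv.swap_apply_of_ne_of_ne h1 h2]
  · intro hq
    obtain ⟨m, hm⟩ := pstep_exact _ hq
    have : ∀ m, ((Equiv.swap x y * π) ^ m) x ∈ S := by
      intro m
      induction m with
      | zero => exact ⟨0, hk0, rfl⟩
      | succ m ih => rw [pow_succ', Equiv.Perm.mul_apply]; exact hS _ ih
    obtain ⟨j, hj, hj'⟩ := this m
    exact hmin j hj (hj'.trans hm)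

/-- generators of connectedness -/
def cstep {X : Type} (inv φ : Equiv.Perm X) : X → X → Prop := fun x y => y = φ x ∨ y = inv x

/-- number of components -/
noncomputable def ncomp {X : Type} (inv φ : Equiv.Perm X) : ℕ := Nat.card (Quot (cstep inv φ))

theorem cstep_phi {X : Type} (inv φ : Equiv.Perm X) (x : X) :
    Quot.mk (cstep inv φ) (φ x) = Quot.mk (cstep inv φ) x :=
  (Quot.sound (show cstep inv φ x (φ x) from Or.inl rfl)).symm

theorem cstep_inv {X : Type} (inv φ : Equiv.Perm X) (x : X) :
    Quot.mk (cstep inv φ) (inv x) = Quot.mk (cstep inv φ) x :=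
  (Quot.sound (show cstep inv φ x (inv x) from Or.inr rfl)).symm

theorem cstep_of_pstep {X : Type} (inv φ : Equiv.Perm X) {x y : X}
    (h : Quot.mk (pstep (φ * inv)) x = Quot.mk (pstep (φ * inv)) y) :
    Quot.mk (cstep inv φ) x = Quot.mk (cstep inv φ) y := by
  have := congrArg (Quot.lift (r := pstep (φ * inv)) (Quot.mk (cstep inv φ)) (by
    rintro a b rfl
    rw [Equiv.Perm.mul_apply, cstep_phi, cstep_inv])) h
  exact this

theorem cstep_of_pstep_phi {X : Type} (inv φ : Equiv.Perm X) {x y : X}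
    (h : Quot.mk (pstep φ) x = Quot.mk (pstep φ) y) :
    Quot.mk (cstep inv φ) x = Quot.mk (cstep inv φ) y := by
  have := congrArg (Quot.lift (r := pstep φ) (Quot.mk (cstep inv φ)) (by
    rintro a b rfl
    rw [cstep_phi])) h
  exact this

theorem cstep_swap_aux {X : Type} [DecidableEq X] (inv φ : Equiv.Perm X) (x y : X) (a b : X)
    (h : cstep inv φ a b) :
    Quot.mk (cstep inv (Equiv.swap x y * φ)) a = Quot.mk (cstep inv (Equiv.swap x y * φ)) b ∨
      (Quot.mk (cstep inv (Equiv.swap x y * φ)) a = Quot.mk (cstep inv (Equiv.swap x y * φ)) x ∧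
        Quot.mk (cstep inv (Equiv.swap x y * φ)) b = Quot.mk (cstep inv (Equiv.swap x y * φ)) y) ∨
      (Quot.mk (cstep inv (Equiv.swap x y * φ)) a = Quot.mk (cstep inv (Equiv.swap x y * φ)) y ∧
        Quot.mk (cstep inv (Equiv.swap x y * φ)) b = Quot.mk (cstep inv (Equiv.swap x y * φ)) x) := by
  rcases h with rfl | rfl
  · rw [← cstep_phi inv (Equiv.swap x y * φ) a, Equiv.Perm.mul_apply]
    by_cases h1 : φ a = x
    · rw [h1]; simp
    by_cases h2 : φ a = y
    · rw [h2]; simp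
    rw [Equiv.swap_apply_of_ne_of_ne h1 h2]; simp
  · left; rw [cstep_inv]

theorem ncomp_swap_le_succ {X : Type} [Finite X] [DecidableEq X] (inv φ : Equiv.Perm X) (x y : X) :
    ncomp inv (Equiv.swap x y * φ) ≤ ncomp inv φ + 1 :=
  quot_card_le_succ (x := x) (y := y) (cstep_swap_aux inv φ x y)

theorem cstep_swap_aux2 {X : Type} [DecidableEq X] (inv φ : Equiv.Perm X) (x y : X)
    (h : Quot.mk (cstep inv (Equiv.swap x y * φ)) x = Quot.mk (cstep inv (Equiv.swap x y * φ)) y)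
    (a b : X) (hab : cstep inv φ a b) :
    Quot.mk (cstep inv (Equiv.swap x y * φ)) a = Quot.mk (cstep inv (Equiv.swap x y * φ)) b := by
  rcases cstep_swap_aux inv φ x y a b hab with h1 | ⟨h1, h2⟩ | ⟨h1, h2⟩
  · exact h1
  · rw [h1, h2, h]
  · rw [h1, h2, h]

theorem ncomp_swap_le {X : Type} [Finite X] [DecidableEq X] (inv φ : Equiv.Perm X) (x y : X)
    (h : Quot.mk (cstep inv (Equiv.swap x y * φ)) x = Quot.mk (cstep inv (Equiv.swap x y * φ)) y) :
    ncomp inv (Equiv.swap x y * φ) ≤ ncomp inv φ :=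
  quot_card_le (cstep_swap_aux2 inv φ x y h)

theorem ncomp_swap_lt {X : Type} [Finite X] [DecidableEq X] (inv φ : Equiv.Perm X) (x y : X)
    (h : Quot.mk (cstep inv (Equiv.swap x y * φ)) x = Quot.mk (cstep inv (Equiv.swap x y * φ)) y)
    (h' : Quot.mk (cstep inv φ) x ≠ Quot.mk (cstep inv φ) y) :
    ncomp inv (Equiv.swap x y * φ) + 1 ≤ ncomp inv φ :=
  quot_card_lt (cstep_swap_aux2 inv φ x y h) h' h

/-! ### Combinatorial maps with labelled darts -/

/-- inverse letter -/
def flp {α : Type*} (p : α × Bool) : α × Bool := (p.1, !p.2)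

@[simp] theorem flp_flp {α : Type*} (p : α × Bool) : flp (flp p) = p := by simp [flp]

theorem flp_ne {α : Type*} (p : α × Bool) : flp p ≠ p := by
  intro h
  have := congrArg Prod.snd h
  simp [flp] at this

/-- number of nonempty faces -/
def nface {X : Type*} (fs : List (List X)) : ℕ := fs.countP (fun f => !f.isEmpty)

/-- A labelled combinatorial map: `inv` is the edge involution, `φ` the face permutation whose
cycles are listed in `fs`, and the Euler inequality `V - E + F ≥ 2 C` holds. -/
structure IsMap {α : Type*} {X : Type} [Fintype X] (inv φ : Equiv.Perm X) (lab : X → α × Bool)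
    (fs : List (List X)) : Prop where
  inv_inv : ∀ x, inv (inv x) = x
  inv_ne : ∀ x, inv x ≠ x
  lab_inv : ∀ x, lab (inv x) = flp (lab x)
  nodup : fs.flatten.Nodup
  mem : ∀ x, x ∈ fs.flatten
  cyc : ∀ f ∈ fs, f.map φ = f.rotate 1
  euler : 4 * ncomp inv φ + Fintype.card X ≤ 2 * ncyc (φ * inv) + 2 * nface fs

/-- existence of a map with prescribed face words -/
def HasMap {α : Type*} (ws : List (List (α × Bool))) : Prop :=
  ∃ (X : Type) (_ : Fintype X) (_ : DecidableEq X) (inv φ : Equiv.Perm X) (lab : X → α × Bool)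
    (fs : List (List X)), IsMap inv φ lab fs ∧ fs.map (List.map lab) = ws

set_option linter.unusedSectionVars false

section maps
variable {β : Type*} {X : Type} [Fintype X] {inv φ : Equiv.Perm X}
  {lab : X → β × Bool} {fs fs' : List (List X)}

theorem IsMap.perm (h : IsMap inv φ lab fs) (hp : fs.Perm fs') : IsMap inv φ lab fs' where
  inv_inv := h.inv_inv
  inv_ne := h.inv_ne
  lab_inv := h.lab_inv
  nodup := (hp.flatten.nodup_iff).mp h.nodup
  mem x := (hp.flatten.mem_iff).mp (h.mem x)
  cyc f hf := h.cyc f (hp.mem_iff.mpr hf)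
  euler := by
    have := h.euler
    rwa [show nface fs' = nface fs from (hp.countP_eq _).symm]

theorem IsMap.rotate {f : List X} (k : ℕ) (h : IsMap inv φ lab (f :: fs)) :
    IsMap inv φ lab (f.rotate k :: fs) where
  inv_inv := h.inv_inv
  inv_ne := h.inv_ne
  lab_inv := h.lab_inv
  nodup := by
    have hp : (f.rotate k ++ fs.flatten).Perm (f ++ fs.flatten) :=
      (List.rotate_perm f k).append_right _
    rw [List.flatten_cons]
    exact hp.nodup_iff.mpr h.nodup
  mem x := by
    have := h.mem x
    simpa using this
  cyc g hg := by
    rcases List.mem_cons.mp hg with rfl | hg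
    · rw [List.map_rotate, h.cyc f (by simp), List.rotate_rotate, List.rotate_rotate, add_comm]
    · exact h.cyc g (by simp [hg])
  euler := by
    have := h.euler
    have e : nface (f.rotate k :: fs) = nface (f :: fs) := by
      simp only [nface, List.countP_cons]
      have : (f.rotate k).isEmpty = f.isEmpty := by
        rw [Bool.eq_iff_iff]; simp
      rw [this]
    rwa [e]

theorem cyc_conn (φ : Equiv.Perm X) (x z : X) (s : List X)
    (h : (x :: s).map φ = s ++ [z]) : ∀ a ∈ x :: s, Quot.mk (pstep φ) a = Quot.mk (pstep φ) x := by
  induction s generalizing x with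
  | nil => intro a ha; simp at ha; rw [ha]
  | cons y s ih =>
    intro a ha
    rw [List.map_cons, List.cons_append, List.cons.injEq] at h
    rcases List.mem_cons.mp ha with rfl | ha
    · rfl
    · rw [ih y h.2 a ha, ← h.1, pstep_mk]

theorem cyc_iterate (φ : Equiv.Perm X) (x z : X) (s : List X)
    (h : (x :: s).map φ = s ++ [z]) :
    x :: s = List.iterate φ x (s.length + 1) ∧ φ^[s.length + 1] x = z := by
  induction s generalizing x with
  | nil => simp at h; simp [List.iterate, h]
  | cons y s ih =>
    rw [List.map_cons, List.cons_append, List.cons.injEq] at h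
    have := ih y h.2
    rw [List.length_cons, List.iterate, h.1, ← this.1]
    refine ⟨rfl, ?_⟩
    rw [Function.iterate_succ_apply, h.1]; exact this.2

theorem nface_cons_cons (x : X) (s : List X) : nface ((x :: s) :: fs) = nface fs + 1 := by
  simp [nface]

theorem nface_nil_cons : nface ([] :: fs) = nface fs := by
  simp [nface]

theorem cyc_swap_of_not_mem [DecidableEq X] (x y : X) (f : List X) (hx : x ∉ f) (hy : y ∉ f)
    (h : f.map φ = f.rotate 1) : f.map (Equiv.swap x y * φ) = f.rotate 1 := by
  rw [← h]
  apply List.map_congr_left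
  intro a ha
  have : φ a ∈ f := by
    have : φ a ∈ f.map φ := List.mem_map_of_mem ha
    rw [h] at this
    simpa using this
  rw [Equiv.Perm.mul_apply, Equiv.swap_apply_of_ne_of_ne]
  · rintro rfl; exact hx this
  · rintro rfl; exact hy this

theorem map_swap_of_not_mem [DecidableEq X] (x y : X) (f : List X) (hx : x ∉ f) (hy : y ∉ f) :
    f.map (Equiv.swap x y) = f := by
  conv_rhs => rw [← List.map_id f]
  apply List.map_congr_left
  intro a ha
  rw [Equiv.swap_apply_of_ne_of_ne]; · rfl
  · rintro rfl; exact hx ha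
  · rintro rfl; exact hy ha

theorem IsMap.split [DecidableEq X] {x y : X} {s t : List X}
    (h : IsMap inv φ lab ((x :: s ++ y :: t) :: fs)) :
    IsMap inv (Equiv.swap x y * φ) lab ((x :: s) :: (y :: t) :: fs) := by
  have hnd := h.nodup
  have hnd' : ((x :: s) :: (y :: t) :: fs).flatten.Nodup := by simpa using hnd
  have hx : x ∉ s ∧ x ∉ t ∧ x ≠ y ∧ x ∉ fs.flatten := by
    simp only [List.flatten_cons, List.cons_append, List.nodup_cons, List.mem_append,
      List.mem_cons] at hnd
    tauto
  have hy : y ∉ s ∧ y ∉ t ∧ y ∉ fs.flatten := by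
    simp only [List.flatten_cons, List.append_assoc] at hnd
    have h1 := List.disjoint_of_nodup_append hnd
    have h2 := (List.nodup_append'.mp hnd).2.1
    rw [List.cons_append, List.nodup_cons, List.mem_append] at h2
    refine ⟨fun h => h1 (List.mem_cons_of_mem _ h) (by simp), ?_, ?_⟩ <;> tauto
  have hc := h.cyc _ (List.mem_cons_self)
  rw [List.cons_append, List.rotate_cons_succ, List.rotate_zero, List.append_assoc,
    List.cons_append] at hc
  rw [← List.cons_append, List.map_append] at hc
  have hc' : (x :: s).map φ = s ++ [y] ∧ (y :: t).map φ = t ++ [x] := by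
    rw [show s ++ y :: (t ++ [x]) = (s ++ [y]) ++ (t ++ [x]) by simp] at hc
    exact List.append_inj hc (by simp)
  refine ⟨h.inv_inv, h.inv_ne, h.lab_inv, hnd', ?_, ?_, ?_⟩
  · intro z; simpa using h.mem z
  · intro f hf
    simp only [List.mem_cons] at hf
    rcases hf with rfl | rfl | hf
    · rw [Equiv.Perm.coe_mul, ← List.map_map, hc'.1, List.map_append,
        map_swap_of_not_mem x y s hx.1 hy.1]
      simp
    · rw [Equiv.Perm.coe_mul, ← List.map_map, hc'.2, List.map_append,
        map_swap_of_not_mem x y t hx.2.1 hy.2.1]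
      simp
    · apply cyc_swap_of_not_mem
      · exact fun hh => hx.2.2.2 (List.mem_flatten.mpr ⟨f, hf, hh⟩)
      · exact fun hh => hy.2.2 (List.mem_flatten.mpr ⟨f, hf, hh⟩)
      · exact h.cyc f (by simp [hf])
  · have he := h.euler
    rw [List.cons_append, nface_cons_cons] at he
    rw [nface_cons_cons, nface_cons_cons, mul_assoc]
    by_cases hq : Quot.mk (pstep (φ * inv)) x = Quot.mk (pstep (φ * inv)) y
    · have h1 := ncyc_swap_of_eq (φ * inv) x y hx.2.2.1 hq
      have h2 := ncomp_swap_le_succ inv φ x y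
      omega
    · have h1 := ncyc_le_swap (φ * inv) x y
      have h2 := pstep_swap_of_ne (φ * inv) x y hq
      rw [← mul_assoc] at h2
      have h3 := ncomp_swap_le inv φ x y (cstep_of_pstep _ _ h2)
      omega

theorem IsMap.merge [DecidableEq X] {x y : X} {s t : List X}
    (h : IsMap inv φ lab ((x :: s) :: (y :: t) :: fs))
    (hσ : Quot.mk (pstep (φ * inv)) x = Quot.mk (pstep (φ * inv)) y ∨
      Quot.mk (cstep inv φ) x ≠ Quot.mk (cstep inv φ) y) :
    IsMap inv (Equiv.swap x y * φ) lab ((x :: s ++ y :: t) :: fs) := by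
  have hnd' := h.nodup
  have hnd : ((x :: s ++ y :: t) :: fs).flatten.Nodup := by simpa using hnd'
  have hx : x ∉ s ∧ x ∉ t ∧ x ≠ y ∧ x ∉ fs.flatten := by
    simp only [List.flatten_cons, List.cons_append, List.nodup_cons, List.mem_append,
      List.mem_cons] at hnd
    tauto
  have hy : y ∉ s ∧ y ∉ t ∧ y ∉ fs.flatten := by
    simp only [List.flatten_cons, List.append_assoc] at hnd
    have h1 := List.disjoint_of_nodup_append hnd
    have h2 := (List.nodup_append'.mp hnd).2.1
    rw [List.cons_append, List.nodup_cons, List.mem_append] at h2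
    refine ⟨fun h => h1 (List.mem_cons_of_mem _ h) (by simp), ?_, ?_⟩ <;> tauto
  have hc1 := h.cyc (x :: s) (by simp)
  have hc2 := h.cyc (y :: t) (by simp)
  rw [List.rotate_cons_succ, List.rotate_zero] at hc1 hc2
  have hcc : (x :: s ++ y :: t).map (Equiv.swap x y * φ) = (s ++ y :: t) ++ [x] := by
    rw [Equiv.Perm.coe_mul, ← List.map_map, List.map_append, hc1, hc2, List.map_append,
      List.map_append, List.map_append, map_swap_of_not_mem x y s hx.1 hy.1,
      map_swap_of_not_mem x y t hx.2.1 hy.2.1]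
    simp
  refine ⟨h.inv_inv, h.inv_ne, h.lab_inv, hnd, ?_, ?_, ?_⟩
  · intro z; simpa using h.mem z
  · intro f hf
    simp only [List.mem_cons] at hf
    rcases hf with rfl | hf
    · rw [hcc]; simp
    · apply cyc_swap_of_not_mem
      · exact fun hh => hx.2.2.2 (List.mem_flatten.mpr ⟨f, hf, hh⟩)
      · exact fun hh => hy.2.2 (List.mem_flatten.mpr ⟨f, hf, hh⟩)
      · exact h.cyc f (by simp [hf])
  · have he := h.euler
    rw [nface_cons_cons, nface_cons_cons] at he
    rw [List.cons_append, nface_cons_cons, mul_assoc]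
    have hcon : Quot.mk (cstep inv (Equiv.swap x y * φ)) x =
        Quot.mk (cstep inv (Equiv.swap x y * φ)) y := by
      apply cstep_of_pstep_phi
      exact (cyc_conn _ x x (s ++ y :: t) hcc y (by simp)).symm
    rcases hσ with hq | hq
    · have h1 := ncyc_swap_of_eq (φ * inv) x y hx.2.2.1 hq
      have h2 := ncomp_swap_le inv φ x y hcon
      omega
    · have h1 := ncyc_le_swap (φ * inv) x y
      have h3 := ncomp_swap_lt inv φ x y hcon hq
      omega

theorem isMap_nil_cons : IsMap inv φ lab ([] :: fs) ↔ IsMap inv φ lab fs := by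
  constructor
  · intro h
    exact ⟨h.inv_inv, h.inv_ne, h.lab_inv, by simpa using h.nodup, by simpa using h.mem,
      fun f hf => h.cyc f (by simp [hf]), by simpa [nface] using h.euler⟩
  · intro h
    refine ⟨h.inv_inv, h.inv_ne, h.lab_inv, by simpa using h.nodup, by simpa using h.mem,
      ?_, by simpa [nface] using h.euler⟩
    intro f hf
    rcases List.mem_cons.mp hf with rfl | hf
    · simp
    · exact h.cyc f hf

end maps

section surgery
variable {β : Type*} {X : Type} [Fintype X] {inv φ : Equiv.Perm X}
  {lab : X → β × Bool} {fs fs' : List (List X)}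

theorem IsMap.digon [DecidableEq X] {x y : X} (h : IsMap inv φ lab ([x, y] :: fs))
    (hl : lab y = flp (lab x)) : HasMap (fs.map (List.map lab)) := by
  have hxy : x ≠ y := by
    have := h.nodup
    simp only [List.flatten_cons, List.cons_append, List.nodup_cons, List.mem_cons] at this
    tauto
  have hc := h.cyc [x, y] (by simp)
  have hφx : φ x = y := by simpa using congrArg List.head? hc
  have hφy : φ y = x := by simpa [hφx] using hc
  have ii := h.inv_inv
  have ine := h.inv_ne
  let P : X → Prop := fun z => z ≠ x ∧ z ≠ y
  let g : X → X := fun z => if inv z = x then inv y else if inv z = y then inv x else inv z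
  have inj : ∀ {a b}, inv a = inv b → a = b := fun h => inv.injective h
  have flipi : ∀ {a b}, inv a = b → a = inv b := fun h => by rw [← h, ii]
  have gP : ∀ z, P z → P (g z) := by
    rintro z ⟨h1, h2⟩
    simp only [g]
    split_ifs with h3 h4
    · exact ⟨fun h5 => h2 (by rw [flipi h3, ← h5, ii]), ine _⟩
    · exact ⟨ine _, fun h5 => h1 (by rw [flipi h4, ← h5, ii])⟩
    · exact ⟨h3, h4⟩
  have gg : ∀ z, P z → g (g z) = z := by
    rintro z ⟨h1, h2⟩
    simp only [g]
    by_cases h3 : inv z = x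
    · simp only [h3, if_true, ii]
      rw [if_neg hxy.symm, ← h3, ii]
    · by_cases h4 : inv z = y
      · have h5 : z = inv y := flipi h4
        rw [if_neg h3, if_pos h4, ii, if_pos rfl, h5]
      · simp only [h3, h4, if_false, ii, h1, h2]
  let inv' : Equiv.Perm {z // P z} :=
    Function.Involutive.toPerm (fun z => ⟨g z.1, gP z.1 z.2⟩) (fun z => Subtype.ext (gg z.1 z.2))
  have hinv' : ∀ z : {z // P z}, (inv' z).1 = g z.1 := fun z => rfl
  have φP : ∀ z, P (φ z) ↔ P z := by
    intro z
    simp only [P]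
    have e1 : φ z = x ↔ z = y := by rw [← hφy]; exact φ.injective.eq_iff
    have e2 : φ z = y ↔ z = x := by rw [← hφx]; exact φ.injective.eq_iff
    rw [ne_eq, ne_eq, e1, e2]; tauto
  let φ' : Equiv.Perm {z // P z} := φ.subtypePerm φP
  have hφ' : ∀ z : {z // P z}, (φ' z).1 = φ z.1 := fun z => rfl
  have hfs : ∀ f ∈ fs, ∀ z ∈ f, P z := by
    intro f hf z hz
    have hn := h.nodup
    rw [List.flatten_cons] at hn
    have := List.disjoint_of_nodup_append hn
    have hz' : z ∈ fs.flatten := List.mem_flatten.mpr ⟨f, hf, hz⟩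
    constructor
    · rintro rfl; exact this (by simp) hz'
    · rintro rfl; exact this (by simp) hz'
  obtain ⟨fs₂, hfs₂⟩ : ∃ fs₂ : List (List {z // P z}), fs₂.map (List.map Subtype.val) = fs := by
    refine ⟨fs.pmap (fun f hf => f.pmap Subtype.mk hf) hfs, ?_⟩
    rw [List.map_pmap]
    simp [List.map_pmap]
  have hflat : fs₂.flatten.map Subtype.val = fs.flatten := by
    rw [List.map_flatten, hfs₂]
  have hcard : Fintype.card {z // P z} + 2 = Fintype.card X := by
    have h1 := Fintype.card_subtype_compl P
    have h2 : Fintype.card {z // ¬ P z} = 2 := by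
      rw [Fintype.card_subtype]
      rw [show (Finset.univ.filter fun z => ¬ P z) = {x, y} by
        ext z; simp only [P, Finset.mem_filter, Finset.mem_univ, true_and, Finset.mem_insert,
          Finset.mem_singleton]; tauto]
      exact Finset.card_pair hxy
    have h3 := Fintype.card_subtype_le P
    omega
  have hnf : nface fs₂ = nface fs := by
    rw [← hfs₂]
    simp only [nface, List.countP_map]
    congr 1
    funext f
    cases f <;> rfl
  have he := h.euler
  rw [nface_cons_cons] at he
  refine ⟨{z // P z}, inferInstance, inferInstance, inv', φ', fun z => lab z.1, fs₂, ?_, ?_⟩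
  · refine ⟨?_, ?_, ?_, ?_, ?_, ?_, ?_⟩
    · intro z; exact Subtype.ext (gg z.1 z.2)
    · intro z hz
      have hz := congrArg Subtype.val hz
      rw [hinv'] at hz
      simp only [g] at hz
      split_ifs at hz with h3 h4
      · exact hxy (by rw [← h3, ← hz, ii])
      · exact hxy (by rw [← h4, ← hz, ii])
      · exact ine _ hz
    · intro z
      show lab (g z.1) = _
      simp only [g]
      split_ifs with h3 h4
      · rw [h.lab_inv, hl, ← h3, h.lab_inv]; simp
      · rw [h.lab_inv, ← h.lab_inv z.1, h4, hl]
      · exact h.lab_inv _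
    · have hn := h.nodup
      rw [List.flatten_cons, ← hflat] at hn
      exact List.Nodup.of_map _ (List.nodup_append'.mp hn).2.1
    · intro z
      have hm := h.mem z.1
      rw [List.flatten_cons, List.mem_append, ← hflat] at hm
      rcases hm with hm | hm
      · simp only [List.mem_cons, List.not_mem_nil, or_false] at hm
        rcases hm with hm | hm
        · exact absurd hm z.2.1
        · exact absurd hm z.2.2
      · obtain ⟨z', hz', e⟩ := List.mem_map.mp hm
        rwa [← Subtype.ext e]
    · intro f hf
      have hf2 : f.map Subtype.val ∈ fs := by rw [← hfs₂]; exact List.mem_map_of_mem hf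
      have := h.cyc _ (List.mem_cons_of_mem _ hf2)
      apply (List.map_injective_iff.mpr (Subtype.val_injective (p := P)))
      rw [List.map_rotate, ← this, List.map_map, List.map_map]
      rfl
    · rw [hnf]
      by_cases hA : inv x = y
      · have hA' : inv y = x := by rw [← hA, ii]
        have hz1 : ∀ z, P z → inv z ≠ x := fun z hz h1 => hz.2 (by rw [flipi h1, hA])
        have hz2 : ∀ z, P z → inv z ≠ y := fun z hz h1 => hz.1 (by rw [flipi h1, hA'])
        have e1 : ncyc (φ * inv) ≤ ncyc (φ' * inv') + 1 + 1 := by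
          unfold ncyc
          rw [← Finite.card_option, ← Finite.card_option]
          let k : Quot (pstep (φ' * inv')) → Quot (pstep (φ * inv)) :=
            Quot.lift (fun z => Quot.mk _ z.1) (by
              rintro a b rfl
              have : ((φ' * inv') a).1 = (φ * inv) a.1 := by
                show φ (g a.1) = φ (inv a.1)
                simp only [g, if_neg (hz1 _ a.2), if_neg (hz2 _ a.2)]
              rw [this, pstep_mk])
          refine Nat.card_le_card_of_surjective
            (fun o : Option (Option (Quot (pstep (φ' * inv')))) =>
              o.elim (Quot.mk _ x) (fun o => o.elim (Quot.mk _ y) k)) ?_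
          rintro ⟨a⟩
          by_cases h1 : a = x
          · exact ⟨none, by rw [h1]; rfl⟩
          by_cases h2 : a = y
          · exact ⟨some none, by rw [h2]; rfl⟩
          exact ⟨some (some (Quot.mk _ ⟨a, h1, h2⟩)), rfl⟩
        have e2 : ncomp inv' φ' + 1 ≤ ncomp inv φ := by
          unfold ncomp
          rw [← Finite.card_option]
          refine Nat.card_le_card_of_surjective
            (Quot.lift (fun z => if hz : P z then some (Quot.mk _ (⟨z, hz⟩ : {z // P z})) else none)
              ?_) ?_
          · rintro a b (rfl | rfl)
            · by_cases ha : P a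
              · rw [dif_pos ha, dif_pos ((φP a).mpr ha)]
                exact congrArg some (cstep_phi inv' φ' ⟨a, ha⟩).symm
              · rw [dif_neg ha, dif_neg (fun h => ha ((φP a).mp h))]
            · by_cases ha : P a
              · have : (inv' ⟨a, ha⟩).1 = inv a := by
                  show g a = inv a
                  simp only [g, if_neg (hz1 _ ha), if_neg (hz2 _ ha)]
                have hb : P (inv a) := this ▸ (inv' ⟨a, ha⟩).2
                rw [dif_pos ha, dif_pos hb]
                have e := cstep_inv inv' φ' ⟨a, ha⟩
                rw [← e]
                exact congrArg (fun z => some (Quot.mk _ z)) (Subtype.ext this)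
              · have hb : ¬ P (inv a) := by
                  intro hb
                  apply ha
                  have := gP _ hb
                  have e : g (inv a) = a := by
                    simp only [g]
                    rw [if_neg (hz1 _ hb), if_neg (hz2 _ hb), ii]
                  rwa [e] at this
                rw [dif_neg ha, dif_neg hb]
          · rintro (_ | ⟨⟨a, ha⟩⟩)
            · exact ⟨Quot.mk _ x, by
                show (if hz : P x then _ else none) = none
                rw [dif_neg (fun h => h.1 rfl)]⟩
            · exact ⟨Quot.mk _ a, by
                show (if hz : P a then _ else none) = _
                rw [dif_pos ha]⟩
        omega
      · have hA' : inv y ≠ x := fun h1 => hA (by rw [← h1, ii])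
        have hPx : P (inv x) := ⟨ine _, hA⟩
        have hPy : P (inv y) := ⟨hA', ine _⟩
        have e1 : ncyc (φ * inv) ≤ ncyc (φ' * inv') := by
          refine Nat.card_le_card_of_surjective (Quot.lift (fun z => Quot.mk _ z.1) ?_) ?_
          · rintro a b rfl
            have hval : ((φ' * inv') a).1 = φ (g a.1) := rfl
            rw [hval]
            simp only [g]
            split_ifs with h3 h4
            · have q1 := pstep_mk (φ * inv) a.1
              have q2 := pstep_mk (φ * inv) y
              rw [Equiv.Perm.mul_apply] at q1 q2
              rw [h3, hφx] at q1
              rw [← q1, ← q2]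
            · have q1 := pstep_mk (φ * inv) a.1
              have q2 := pstep_mk (φ * inv) x
              rw [Equiv.Perm.mul_apply] at q1 q2
              rw [h4, hφy] at q1
              rw [← q1, ← q2]
            · exact (pstep_mk (φ * inv) a.1).symm
          · rintro ⟨a⟩
            by_cases h1 : a = x
            · exact ⟨Quot.mk _ ⟨φ (inv x), (φP _).mpr hPx⟩, by
                rw [h1]; exact pstep_mk (φ * inv) x⟩
            by_cases h2 : a = y
            · exact ⟨Quot.mk _ ⟨φ (inv y), (φP _).mpr hPy⟩, by
                rw [h2]; exact pstep_mk (φ * inv) y⟩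
            exact ⟨Quot.mk _ ⟨a, h1, h2⟩, rfl⟩
        have e2 : ncomp inv' φ' ≤ ncomp inv φ := by
          let k : X → Quot (cstep inv' φ') := fun z =>
            if hz : P z then Quot.mk _ (⟨z, hz⟩ : {z // P z}) else Quot.mk _ ⟨inv x, hPx⟩
          have kP : ∀ z (hz : P z), k z = Quot.mk _ ⟨z, hz⟩ := fun z hz => dif_pos hz
          have kN : ∀ z, ¬ P z → k z = Quot.mk _ ⟨inv x, hPx⟩ := fun z hz => dif_neg hz
          have kix : k (inv x) = Quot.mk _ ⟨inv x, hPx⟩ := kP _ _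
          have kiy : k (inv y) = Quot.mk _ ⟨inv x, hPx⟩ := by
            rw [kP _ hPy, ← cstep_inv inv' φ' ⟨inv x, hPx⟩]
            refine congrArg (Quot.mk _) (Subtype.ext ?_)
            show inv y = g (inv x)
            simp only [g, ii, if_true]
          have kx : k x = Quot.mk _ ⟨inv x, hPx⟩ := kN _ (fun h => h.1 rfl)
          have ky : k y = Quot.mk _ ⟨inv x, hPx⟩ := kN _ (fun h => h.2 rfl)
          refine Nat.card_le_card_of_surjective (Quot.lift k ?_) ?_
          · rintro a b (rfl | rfl)
            · by_cases ha : P a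
              · rw [kP a ha, kP _ ((φP a).mpr ha)]
                exact (cstep_phi inv' φ' ⟨a, ha⟩).symm
              · rw [kN a ha, kN _ (fun h => ha ((φP a).mp h))]
            · by_cases h1 : a = x
              · rw [h1, kx, kix]
              by_cases h2 : a = y
              · rw [h2, ky, kiy]
              by_cases h3 : inv a = x
              · rw [h3, kx, flipi h3, kix]
              by_cases h4 : inv a = y
              · rw [h4, ky, flipi h4, kiy]
              rw [kP a ⟨h1, h2⟩, kP (inv a) ⟨h3, h4⟩, ← cstep_inv inv' φ' ⟨a, h1, h2⟩]
              refine congrArg (Quot.mk _) (Subtype.ext ?_)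
              show g a = inv a
              simp only [g, if_neg h3, if_neg h4]
          · rintro ⟨a, ha⟩
            exact ⟨Quot.mk _ a, kP a ha⟩
        omega
  · rw [← hfs₂, List.map_map]
    apply List.map_congr_left
    intro f _
    simp

end surgery

theorem IsMap.union {β : Type*} {X Y : Type} [Fintype X] [Fintype Y] {inv φ : Equiv.Perm X}
    {lab : X → β × Bool} {fs : List (List X)} {inv' φ' : Equiv.Perm Y}
    {lab' : Y → β × Bool} {fs' : List (List Y)}
    (h : IsMap inv φ lab fs) (h' : IsMap inv' φ' lab' fs') :
    IsMap (Equiv.sumCongr inv inv') (Equiv.sumCongr φ φ') (Sum.elim lab lab')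
      (fs.map (List.map Sum.inl) ++ fs'.map (List.map Sum.inr)) where
  inv_inv := by rintro (x | x) <;> simp [h.inv_inv, h'.inv_inv]
  inv_ne := by rintro (x | x) <;> simp [h.inv_ne, h'.inv_ne]
  lab_inv := by rintro (x | x) <;> simp [h.lab_inv, h'.lab_inv]
  nodup := by
    rw [List.flatten_append, ← List.map_flatten, ← List.map_flatten, List.nodup_append']
    refine ⟨h.nodup.map Sum.inl_injective, h'.nodup.map Sum.inr_injective, ?_⟩
    intro x h1 h2
    obtain ⟨a, _, rfl⟩ := List.mem_map.mp h1
    obtain ⟨b, _, hb⟩ := List.mem_map.mp h2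
    cases hb
  mem := by
    rw [List.flatten_append, ← List.map_flatten, ← List.map_flatten]
    rintro (x | x)
    · exact List.mem_append_left _ (List.mem_map_of_mem (h.mem x))
    · exact List.mem_append_right _ (List.mem_map_of_mem (h'.mem x))
  cyc := by
    intro f hf
    rcases List.mem_append.mp hf with hf | hf
    · obtain ⟨g, hg, rfl⟩ := List.mem_map.mp hf
      rw [← List.map_rotate, ← h.cyc g hg, List.map_map, List.map_map]; rfl
    · obtain ⟨g, hg, rfl⟩ := List.mem_map.mp hf
      rw [← List.map_rotate, ← h'.cyc g hg, List.map_map, List.map_map]; rfl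
  euler := by
    have e1 := h.euler
    have e2 := h'.euler
    have e3 : nface (fs.map (List.map (Sum.inl : X → X ⊕ Y)) ++ fs'.map (List.map Sum.inr))
        = nface fs + nface fs' := by
      simp only [nface, List.countP_append, List.countP_map]
      congr 2
      · funext f; cases f <;> rfl
      · funext f; cases f <;> rfl
    have e4 : ncomp (Equiv.sumCongr inv inv') (Equiv.sumCongr φ φ') ≤
        ncomp inv φ + ncomp inv' φ' := by
      unfold ncomp
      rw [← Nat.card_sum]
      refine Nat.card_le_card_of_surjective (Sum.elim
        (Quot.lift (fun x => Quot.mk _ (Sum.inl x)) ?_)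
        (Quot.lift (fun x => Quot.mk _ (Sum.inr x)) ?_)) ?_
      · rintro a b (rfl | rfl)
        · exact (cstep_phi (Equiv.sumCongr inv inv') (Equiv.sumCongr φ φ') (Sum.inl a)).symm
        · exact (cstep_inv (Equiv.sumCongr inv inv') (Equiv.sumCongr φ φ') (Sum.inl a)).symm
      · rintro a b (rfl | rfl)
        · exact (cstep_phi (Equiv.sumCongr inv inv') (Equiv.sumCongr φ φ') (Sum.inr a)).symm
        · exact (cstep_inv (Equiv.sumCongr inv inv') (Equiv.sumCongr φ φ') (Sum.inr a)).symm
      · rintro ⟨a | a⟩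
        · exact ⟨Sum.inl (Quot.mk _ a), rfl⟩
        · exact ⟨Sum.inr (Quot.mk _ a), rfl⟩
    have e5 : ncyc (φ * inv) + ncyc (φ' * inv') ≤
        ncyc ((Equiv.sumCongr φ φ' : Equiv.Perm (X ⊕ Y)) * Equiv.sumCongr inv inv') := by
      unfold ncyc
      rw [← Nat.card_sum]
      refine Nat.card_le_card_of_surjective
        (Quot.lift (Sum.elim (fun x => Sum.inl (Quot.mk _ x)) (fun x => Sum.inr (Quot.mk _ x))) ?_)
        ?_
      · rintro (a | a) b rfl
        · exact congrArg Sum.inl (pstep_mk (φ * inv) a).symm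
        · exact congrArg Sum.inr (pstep_mk (φ' * inv') a).symm
      · rintro (⟨⟨a⟩⟩ | ⟨⟨a⟩⟩)
        · exact ⟨Quot.mk _ (Sum.inl a), rfl⟩
        · exact ⟨Quot.mk _ (Sum.inr a), rfl⟩
    rw [e3, Fintype.card_sum]
    omega

section hasMap
variable {β : Type*} {ws ws' : List (List (β × Bool))} {w w' : List (β × Bool)}

theorem HasMap.perm (h : HasMap ws) (hp : ws.Perm ws') : HasMap ws' := by
  obtain ⟨X, _, _, inv, φ, lab, fs, hm, rfl⟩ := h
  obtain ⟨fs', h1, h2⟩ : ∃ fs', fs'.map (List.map lab) = ws' ∧ fs.Perm fs' := by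
    have h1 : Relation.Comp (fun a b => a = List.map (List.map lab) b) List.Perm ws' fs := by
      rw [List.eq_map_comp_perm]
      exact hp.symm
    obtain ⟨l, h2, h3⟩ := h1
    exact ⟨l, h2.symm, h3.symm⟩
  exact ⟨X, inferInstance, inferInstance, inv, φ, lab, fs', hm.perm h2, h1⟩

theorem hasMap_nil_cons : HasMap ([] :: ws) ↔ HasMap ws := by
  constructor
  · rintro ⟨X, _, _, inv, φ, lab, fs, hm, he⟩
    cases fs with
    | nil => simp at he
    | cons f fs =>
      simp only [List.map_cons, List.cons.injEq, List.map_eq_nil_iff] at he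
      obtain ⟨rfl, rfl⟩ := he
      exact ⟨X, inferInstance, inferInstance, inv, φ, lab, fs, isMap_nil_cons.mp hm, rfl⟩
  · rintro ⟨X, _, _, inv, φ, lab, fs, hm, rfl⟩
    exact ⟨X, inferInstance, inferInstance, inv, φ, lab, [] :: fs, isMap_nil_cons.mpr hm, rfl⟩

theorem HasMap.rotate (k : ℕ) (h : HasMap (w :: ws)) : HasMap (w.rotate k :: ws) := by
  obtain ⟨X, _, _, inv, φ, lab, fs, hm, he⟩ := h
  cases fs with
  | nil => simp at he
  | cons f fs =>
    simp only [List.map_cons, List.cons.injEq] at he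
    obtain ⟨rfl, rfl⟩ := he
    exact ⟨X, inferInstance, inferInstance, inv, φ, lab, f.rotate k :: fs, hm.rotate k, by simp [List.map_rotate]⟩

theorem HasMap.comm (h : HasMap ((w ++ w') :: ws)) : HasMap ((w' ++ w) :: ws) := by
  have := h.rotate w.length
  rwa [List.rotate_append_length_eq] at this

theorem HasMap.split (h : HasMap ((w ++ w') :: ws)) : HasMap (w :: w' :: ws) := by
  cases w with
  | nil => exact hasMap_nil_cons.mpr h
  | cons a w =>
  cases w' with
  | nil =>
    rw [List.append_nil] at h
    exact (hasMap_nil_cons.mpr h).perm (List.Perm.swap _ _ _)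
  | cons b w' =>
    obtain ⟨X, _, _, inv, φ, lab, fs, hm, he⟩ := h
    cases fs with
    | nil => simp at he
    | cons f fs =>
      simp only [List.map_cons, List.cons.injEq] at he
      obtain ⟨he, rfl⟩ := he
      obtain ⟨f1, f2, rfl, h1, h2⟩ := List.map_eq_append_iff.mp he
      obtain ⟨x, s, rfl, rfl, rfl⟩ := List.map_eq_cons_iff.mp h1
      obtain ⟨y, t, rfl, rfl, rfl⟩ := List.map_eq_cons_iff.mp h2
      exact ⟨X, inferInstance, inferInstance, inv, _, lab, _, hm.split, rfl⟩

theorem HasMap.merge (h : HasMap (w :: ws)) (h' : HasMap (w' :: ws')) :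
    HasMap ((w ++ w') :: (ws ++ ws')) := by
  obtain ⟨X, _, _, inv, φ, lab, fs, hm, he⟩ := h
  obtain ⟨Y, _, _, inv', φ', lab', fs', hm', he'⟩ := h'
  cases fs with
  | nil => simp at he
  | cons f fs =>
  cases fs' with
  | nil => simp at he'
  | cons f' fs' =>
  simp only [List.map_cons, List.cons.injEq] at he he'
  obtain ⟨rfl, rfl⟩ := he
  obtain ⟨rfl, rfl⟩ := he'
  have hu := hm.union hm'
  have hl1 : ∀ g : List X, (g.map Sum.inl).map (Sum.elim lab lab') = g.map lab := by
    intro g; rw [List.map_map]; rfl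
  have hl2 : ∀ g : List Y, (g.map Sum.inr).map (Sum.elim lab lab') = g.map lab' := by
    intro g; rw [List.map_map]; rfl
  have hu2 := hu.perm (fs' := (f.map Sum.inl) :: (f'.map Sum.inr) ::
    (fs.map (List.map Sum.inl) ++ fs'.map (List.map Sum.inr))) (by
      simp only [List.map_cons, List.cons_append]
      exact List.Perm.cons _ List.perm_middle)
  have hrest : (fs.map (List.map Sum.inl) ++ fs'.map (List.map Sum.inr)).map
      (List.map (Sum.elim lab lab')) = fs.map (List.map lab) ++ fs'.map (List.map lab') := by
    simp only [List.map_append, List.map_map]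
    congr 1 <;> (apply List.map_congr_left; intro g _; simp)
  cases f with
  | nil =>
    exact ⟨_, inferInstance, inferInstance, _, _, _, _, isMap_nil_cons.mp hu2, by
      rw [List.map_cons, hrest, hl2]; rfl⟩
  | cons x s =>
  cases f' with
  | nil =>
    exact ⟨_, inferInstance, inferInstance, _, _, _, _, isMap_nil_cons.mp (hu2.perm (List.Perm.swap _ _ _)), by
      rw [List.map_cons, hrest, hl1]; simp⟩
  | cons y t =>
    have hq : Quot.mk (cstep (Equiv.sumCongr inv inv') (Equiv.sumCongr φ φ')) (Sum.inl x) ≠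
        Quot.mk (cstep (Equiv.sumCongr inv inv') (Equiv.sumCongr φ φ')) (Sum.inr y) := by
      intro hq
      have := congrArg (Quot.lift (fun z : X ⊕ Y => z.isLeft) (by
        rintro (a | a) b (rfl | rfl) <;> rfl)) hq
      exact absurd this (by simp)
    refine ⟨_, inferInstance, inferInstance, _, _, _, _, hu2.merge (Or.inr hq), ?_⟩
    rw [List.map_cons, hrest, List.map_append]
    have e1 := hl1 (x :: s)
    have e2 := hl2 (y :: t)
    rw [List.map_cons] at e1 e2
    rw [e1, e2]

theorem HasMap.digon {a : β × Bool} (h : HasMap ([a, flp a] :: ws)) : HasMap ws := by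
  obtain ⟨X, _, _, inv, φ, lab, fs, hm, he⟩ := h
  cases fs with
  | nil => simp at he
  | cons f fs =>
    simp only [List.map_cons, List.cons.injEq] at he
    obtain ⟨he, rfl⟩ := he
    obtain ⟨x, s, rfl, rfl, h1⟩ := List.map_eq_cons_iff.mp he
    obtain ⟨y, t, rfl, h2, h3⟩ := List.map_eq_cons_iff.mp h1
    rw [List.map_eq_nil_iff] at h3
    subst h3
    exact hm.digon h2

theorem HasMap.fold {a : β × Bool} (h : HasMap ((w ++ a :: flp a :: w') :: ws)) :
    HasMap ((w ++ w') :: ws) := by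
  have h1 := h.comm
  rw [List.cons_append, List.cons_append] at h1
  have h2 : HasMap (([a, flp a] ++ (w' ++ w)) :: ws) := h1
  exact h2.split.digon.comm

theorem HasMap.red (h : HasMap (w :: ws)) (hr : FreeGroup.Red w w') : HasMap (w' :: ws) := by
  induction hr with
  | refl => exact h
  | tail _ hs ih =>
    cases hs with
    | not => exact ih.fold

theorem hasMap_empty : HasMap ([] : List (List (β × Bool))) := by
  refine ⟨Empty, inferInstance, inferInstance, 1, 1, Empty.elim, [], ⟨?_, ?_, ?_, ?_, ?_, ?_, ?_⟩, rfl⟩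
  · exact fun x => x.elim
  · exact fun x => x.elim
  · exact fun x => x.elim
  · simp
  · exact fun x => x.elim
  · simp
  · have : ncomp (1 : Equiv.Perm Empty) 1 = 0 := by
      unfold ncomp
      have : IsEmpty (Quot (cstep (1 : Equiv.Perm Empty) 1)) := ⟨by rintro ⟨a⟩; exact a.elim⟩
      exact Nat.card_of_isEmpty
    rw [this]; simp

theorem hasMap_hair (a : β × Bool) : HasMap [[a, flp a]] := by
  refine ⟨Bool, inferInstance, inferInstance, Equiv.boolNot, Equiv.boolNot,
    fun b => if b then a else flp a, [[true, false]], ⟨?_, ?_, ?_, ?_, ?_, ?_, ?_⟩, rfl⟩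
  · simp
  · simp
  · rintro (_ | _) <;> simp
  · simp
  · simp
  · simp
  · have h1 : (Equiv.boolNot * Equiv.boolNot : Equiv.Perm Bool) = 1 := by ext x; simp
    have h2 : ncyc (1 : Equiv.Perm Bool) = 2 := by
      apply le_antisymm
      · unfold ncyc
        have := Nat.card_le_card_of_surjective (Quot.mk (pstep (1 : Equiv.Perm Bool)))
          (fun q => Quot.exists_rep q)
        simpa using this
      · have := Nat.card_le_card_of_surjective
          (Quot.lift (r := pstep (1 : Equiv.Perm Bool)) id (by rintro a b rfl; rfl))
          (fun b => ⟨Quot.mk _ b, rfl⟩)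
        simpa [ncyc] using this
    have h3 : ncomp Equiv.boolNot Equiv.boolNot ≤ 1 := by
      unfold ncomp
      rw [Finite.card_le_one_iff_subsingleton]
      constructor
      have : ∀ b, Quot.mk (cstep Equiv.boolNot Equiv.boolNot) b =
          Quot.mk (cstep Equiv.boolNot Equiv.boolNot) true := by
        rintro (_ | _)
        · exact cstep_inv Equiv.boolNot Equiv.boolNot true
        · rfl
      rintro ⟨a⟩ ⟨b⟩
      exact (this a).trans (this b).symm
    rw [h1, h2]
    simp [nface]
    omega

theorem HasMap.conj (a : β × Bool) (h : HasMap (w :: ws)) :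
    HasMap ((a :: w ++ [flp a]) :: ws) := by
  have h1 := h.merge (hasMap_hair (flp a))
  rw [flp_flp, List.append_nil] at h1
  have h2 : HasMap (((w ++ [flp a]) ++ [a]) :: ws) := by simpa using h1
  exact h2.comm

theorem HasMap.conj_word (g : List (β × Bool)) (h : HasMap (w :: ws)) :
    HasMap ((g ++ w ++ FreeGroup.invRev g) :: ws) := by
  induction g with
  | nil => simpa [FreeGroup.invRev] using h
  | cons a g ih =>
    have := ih.conj a
    convert this using 2
    simp [FreeGroup.invRev, flp]

theorem hasMap_sphere (r : List (β × Bool)) : HasMap [r, FreeGroup.invRev r] := by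
  have h := (hasMap_nil_cons.mpr hasMap_empty).conj_word r
  rw [List.append_nil] at h
  exact h.split

end hasMap

/-! ### Existence of maps for elements of the normal closure -/

/-- the nonempty words representing elements of the symmetrized closure -/
def relWords {β : Type*} [DecidableEq β] (R : Set (FreeGroup β)) : Set (List (β × Bool)) :=
  {w | w ≠ [] ∧ ∃ g ∈ symClosure R, g.toWord = w}

section exist
variable {β : Type*} [DecidableEq β] {R : Set (FreeGroup β)}

theorem invRev_rotate_exists (w : List (β × Bool)) (i : ℕ) :
    ∃ j, FreeGroup.invRev (w.rotate i) = (FreeGroup.invRev w).rotate j := by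
  refine ⟨w.length - i % w.length, ?_⟩
  simp only [FreeGroup.invRev]
  rw [List.map_rotate, List.reverse_rotate, List.length_map]

theorem relWords_reduced {w : List (β × Bool)}
    (hw : w ∈ relWords R) : FreeGroup.IsReduced w := by
  obtain ⟨_, g, _, rfl⟩ := hw
  exact FreeGroup.isReduced_toWord

theorem relWords_rotate (hcyc : ∀ r ∈ R, IsCyclicallyReduced r.toWord) {w : List (β × Bool)}
    (hw : w ∈ relWords R) (k : ℕ) : w.rotate k ∈ relWords R := by
  obtain ⟨h0, g, ⟨r, hr, i, hi⟩, rfl⟩ := hw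
  refine ⟨by simpa using h0, ?_⟩
  rcases hi with hi | hi
  · refine ⟨FreeGroup.mk (g.toWord.rotate k), ⟨r, hr, i + k, Or.inl ?_⟩, ?_⟩
    · rw [hi, List.rotate_rotate]; exact hcyc r hr _
    · rw [hi, List.rotate_rotate]; exact hcyc r hr _
  · have key : (FreeGroup.mk ((r⁻¹).toWord.rotate (i + k))).toWord = (r⁻¹).toWord.rotate (i + k) := by
      obtain ⟨j, hj⟩ := invRev_rotate_exists ((r⁻¹).toWord) (i + k)
      rw [FreeGroup.toWord_inv, FreeGroup.invRev_invRev] at hj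
      have h1 := hcyc r hr j
      rw [← hj, ← FreeGroup.inv_mk, FreeGroup.toWord_inv] at h1
      have := FreeGroup.invRev_injective h1
      rw [FreeGroup.toWord_inv]; exact this
    refine ⟨FreeGroup.mk (g.toWord.rotate k), ⟨r, hr, i + k, Or.inr ?_⟩, ?_⟩
    · rw [hi, List.rotate_rotate]; exact key
    · rw [hi, List.rotate_rotate]; exact key

theorem relWords_inv {w : List (β × Bool)}
    (hw : w ∈ relWords R) : FreeGroup.invRev w ∈ relWords R := by
  obtain ⟨h0, g, ⟨r, hr, i, hi⟩, rfl⟩ := hw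
  refine ⟨by simpa [FreeGroup.invRev] using h0, g⁻¹, ⟨r, hr, ?_⟩, FreeGroup.toWord_inv g⟩
  rw [FreeGroup.toWord_inv]
  rcases hi with hi | hi
  · obtain ⟨j, hj⟩ := invRev_rotate_exists r.toWord i
    refine ⟨j, Or.inr ?_⟩
    rw [hi, hj, FreeGroup.toWord_inv]
  · obtain ⟨j, hj⟩ := invRev_rotate_exists (r⁻¹).toWord i
    refine ⟨j, Or.inl ?_⟩
    rw [hi, hj, FreeGroup.toWord_inv, FreeGroup.invRev_invRev]

/-- `g` bounds a map with all other faces in `W` -/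
def Bounds (W : Set (List (β × Bool))) (g : FreeGroup β) : Prop :=
  ∃ rs, (∀ w ∈ rs, w ∈ W) ∧ HasMap (g.toWord :: rs)

theorem Bounds.mul {W : Set (List (β × Bool))} {g h : FreeGroup β} (hg : Bounds W g)
    (hh : Bounds W h) : Bounds W (g * h) := by
  obtain ⟨rs, h1, h2⟩ := hg
  obtain ⟨rs', h1', h2'⟩ := hh
  refine ⟨rs ++ rs', ?_, ?_⟩
  · intro w hw
    rcases List.mem_append.mp hw with hw | hw
    · exact h1 w hw
    · exact h1' w hw
  · rw [FreeGroup.toWord_mul]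
    exact (h2.merge h2').red FreeGroup.reduce.red

theorem Bounds.conj {W : Set (List (β × Bool))} {g : FreeGroup β} (hg : Bounds W g)
    (h : FreeGroup β) : Bounds W (h * g * h⁻¹) := by
  obtain ⟨rs, h1, h2⟩ := hg
  refine ⟨rs, h1, ?_⟩
  have h3 := (h2.conj_word h.toWord).red FreeGroup.reduce.red
  rwa [← FreeGroup.toWord_mk, ← FreeGroup.mul_mk, ← FreeGroup.mul_mk, ← FreeGroup.inv_mk,
    FreeGroup.mk_toWord, FreeGroup.mk_toWord] at h3

theorem bounds_one (W : Set (List (β × Bool))) : Bounds W 1 :=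
  ⟨[], by simp, by rw [FreeGroup.toWord_one]; exact hasMap_nil_cons.mpr hasMap_empty⟩

theorem bounds_of_mem {W : Set (List (β × Bool))} {g : FreeGroup β}
    (h : FreeGroup.invRev g.toWord ∈ W) : Bounds W g :=
  ⟨[FreeGroup.invRev g.toWord], by simpa using h, hasMap_sphere _⟩

theorem bounds_of_mem_normalClosure {g : FreeGroup β} (hg : g ∈ Subgroup.normalClosure R) :
    Bounds (relWords R) g := by
  let K : Subgroup (FreeGroup β) :=
    { carrier := {g | Bounds (relWords R) g ∧ Bounds (relWords R) g⁻¹}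
      one_mem' := by
        refine ⟨bounds_one _, ?_⟩
        rw [inv_one]; exact bounds_one _
      mul_mem' := by
        rintro a b ⟨ha, ha'⟩ ⟨hb, hb'⟩
        refine ⟨ha.mul hb, ?_⟩
        rw [mul_inv_rev]; exact hb'.mul ha'
      inv_mem' := by
        rintro a ⟨ha, ha'⟩
        refine ⟨ha', ?_⟩
        rwa [inv_inv] }
  have hK : K.Normal := ⟨by
    rintro a ⟨ha, ha'⟩ h
    refine ⟨ha.conj h, ?_⟩
    rw [show (h * a * h⁻¹)⁻¹ = h * a⁻¹ * h⁻¹ by group]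
    exact ha'.conj h⟩
  have hle : Subgroup.normalClosure R ≤ K := by
    apply Subgroup.normalClosure_le_normal
    intro r hr
    by_cases h1 : r = 1
    · subst h1; exact K.one_mem
    · have hr' : r.toWord ∈ relWords R := by
        refine ⟨by rwa [Ne, FreeGroup.toWord_eq_nil_iff], r, ⟨r, hr, 0, Or.inl ?_⟩, rfl⟩
        simp
      refine ⟨bounds_of_mem (relWords_inv hr'), bounds_of_mem ?_⟩
      rwa [FreeGroup.toWord_inv, FreeGroup.invRev_invRev]
  exact (hle hg).1

/-- cyclic reduction -/
theorem exists_core (u : FreeGroup β) (hu : u ≠ 1) (hn : u ∈ Subgroup.normalClosure R) :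
    ∃ c : FreeGroup β, c ≠ 1 ∧ c ∈ Subgroup.normalClosure R ∧ c.toWord <:+: u.toWord ∧
      FreeGroup.IsCyclicallyReduced c.toWord := by
  have h1 := FreeGroup.reduceCyclically.conj_conjugator_reduceCyclically u.toWord
  have h2 := FreeGroup.reduceCyclically.isCyclicallyReduced
    (FreeGroup.isReduced_toWord (x := u))
  set c := FreeGroup.reduceCyclically u.toWord
  set g := FreeGroup.reduceCyclically.conjugator u.toWord
  have hc : (FreeGroup.mk c).toWord = c := by
    rw [FreeGroup.toWord_mk]; exact h2.isReduced.reduce_eq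
  have hug : u = FreeGroup.mk g * FreeGroup.mk c * (FreeGroup.mk g)⁻¹ := by
    rw [FreeGroup.inv_mk, FreeGroup.mul_mk, FreeGroup.mul_mk, h1, FreeGroup.mk_toWord]
  refine ⟨FreeGroup.mk c, ?_, ?_, ?_, ?_⟩
  · intro h
    rw [h] at hug
    apply hu
    rw [hug]; group
  · have := Subgroup.normalClosure_normal.conj_mem u hn (FreeGroup.mk g)⁻¹
    rw [hug] at this
    convert this using 1
    group
  · rw [hc]
    exact ⟨g, _, h1⟩
  · rw [hc]; exact h2

theorem rotate_reduced {c : List (β × Bool)} (h : FreeGroup.IsCyclicallyReduced c) (k : ℕ) :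
    FreeGroup.IsReduced (c.rotate k) := by
  have h1 := (h.flatten_replicate 2).isReduced
  have h2 : (List.replicate 2 c).flatten = c ++ c := by simp [List.replicate]
  rw [h2] at h1
  have h3 : c ++ c = (c.take (k % c.length) ++ c.rotate k) ++ c.drop (k % c.length) := by
    rw [List.rotate_eq_drop_append_take_mod, List.append_assoc, List.append_assoc,
      List.take_append_drop, ← List.append_assoc, List.take_append_drop]
  rw [h3] at h1
  exact List.IsChain.right_of_append (List.IsChain.left_of_append h1)

end exist

/-! ### Analysis of a minimal map -/

section cyc
variable {X : Type} [Fintype X] {φ : Equiv.Perm X}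

theorem cyc_minimalPeriod {f : List X} (hc : f.map φ = f.rotate 1) (hn : f.Nodup) {x : X}
    (hx : x ∈ f) : Function.minimalPeriod φ x = f.length ∧
      ∃ k, List.iterate φ x f.length = f.rotate k := by
  obtain ⟨k, hk, rfl⟩ := List.getElem_of_mem hx
  have h1 : f.rotate k = f[k] :: (f.drop (k + 1) ++ f.take k) := by
    rw [List.rotate_eq_drop_append_take hk.le, List.drop_eq_getElem_cons hk, List.cons_append]
  set s := f.drop (k + 1) ++ f.take k
  have hl : s.length + 1 = f.length := by
    rw [← List.length_rotate f k, h1]; rfl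
  have h2 : (f[k] :: s).map φ = s ++ [f[k]] := by
    rw [← h1, List.map_rotate, hc, List.rotate_rotate, add_comm, ← List.rotate_rotate, h1]
    simp
  obtain ⟨h3, h4⟩ := cyc_iterate φ _ _ _ h2
  rw [hl] at h3 h4
  refine ⟨?_, k, by rw [← h3, h1]⟩
  have h5 : Function.IsPeriodicPt φ f.length f[k] := h4
  apply le_antisymm (h5.minimalPeriod_le (by omega))
  by_contra hlt
  push Not at hlt
  have h6 : (List.iterate φ f[k] f.length).Nodup := by
    rw [← h3, ← h1]; exact List.nodup_rotate.mpr hn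
  have hpos : 0 < Function.minimalPeriod φ f[k] :=
    h5.minimalPeriod_pos (by omega)
  have h7 := (List.Nodup.getElem_inj_iff h6 (i := 0) (j := Function.minimalPeriod φ f[k])
    (hi := by simp; omega) (hj := by simpa using hlt)).mp (by
      rw [List.getElem_iterate, List.getElem_iterate]
      exact (Function.isPeriodicPt_minimalPeriod φ f[k]).symm)
  omega

theorem path_initial (h z : X) (t : List X) (hz : (z :: t).map φ = t ++ [h]) (m : ℕ)
    (hm : ∀ i, 1 ≤ i → i < m → φ^[i] z ≠ h) : List.iterate φ z m <+: z :: t := by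
  induction m generalizing z t with
  | zero => simp
  | succ m ih =>
    rw [List.iterate, List.prefix_cons_inj]
    cases m with
    | zero => simp
    | succ m =>
      have h1 : φ z ≠ h := hm 1 le_rfl (by omega)
      cases t with
      | nil => simp at hz; exact absurd hz h1
      | cons a t =>
        rw [List.map_cons, List.cons_append, List.cons.injEq] at hz
        rw [hz.1]
        apply ih _ _ hz.2
        intro i hi hi'
        have := hm (i + 1) (by omega) (by omega)
        rwa [Function.iterate_succ_apply, hz.1] at this

theorem cyc_sub {f : List X} (hc : f.map φ = f.rotate 1) {h z : X} (hh : f.head? = some h)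
    (hz : z ∈ f) (m : ℕ) (hm : ∀ i, 1 ≤ i → i < m → φ^[i] z ≠ h) :
    List.iterate φ z m <:+: f := by
  obtain ⟨s, t, rfl⟩ := List.append_of_mem hz
  have key : (z :: t).map φ = t ++ [h] := by
    cases s with
    | nil =>
      simp at hh
      subst hh
      simpa using hc
    | cons a s =>
      simp at hh
      subst hh
      have h1 : (List.map φ (a :: s)) ++ List.map φ (z :: t) = (s ++ [z]) ++ (t ++ [a]) := by
        simpa using hc
      exact (List.append_inj h1 (by simp)).2
  exact (path_initial h z t key m hm).isInfix.trans (List.suffix_append _ _).isInfix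

end cyc

/-- reading `n` labels forward from `x` -/
def rd {β : Type*} {X : Type} (φ : Equiv.Perm X) (lab : X → β × Bool) (x : X) (n : ℕ) :
    List (β × Bool) := (List.iterate φ x n).map lab

/-- reading `n` inverse labels backward from `x` -/
def rdb {β : Type*} {X : Type} (φ : Equiv.Perm X) (lab : X → β × Bool) (x : X) (n : ℕ) :
    List (β × Bool) := (List.iterate φ.symm x n).map (fun z => flp (lab z))

section read
variable {β : Type*} {X : Type} {φ : Equiv.Perm X} {lab : X → β × Bool}

theorem rd_length (x : X) (n : ℕ) : (rd φ lab x n).length = n := by simp [rd]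
theorem rdb_length (x : X) (n : ℕ) : (rdb φ lab x n).length = n := by simp [rdb]

theorem rd_getElem (x : X) (n i : ℕ) (h : i < (rd φ lab x n).length) :
    (rd φ lab x n)[i] = lab (φ^[i] x) := by simp [rd]
theorem rdb_getElem (x : X) (n i : ℕ) (h : i < (rdb φ lab x n).length) :
    (rdb φ lab x n)[i] = flp (lab (φ.symm^[i] x)) := by simp [rdb]

theorem rd_initial (x : X) {m n : ℕ} (h : m ≤ n) : rd φ lab x m <+: rd φ lab x n := by
  rw [List.prefix_iff_eq_take, rd_length]
  apply List.ext_getElem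
  · simp [rd_length, h]
  · intro i h1 h2
    rw [List.getElem_take, rd_getElem, rd_getElem]

theorem rdb_initial (x : X) {m n : ℕ} (h : m ≤ n) : rdb φ lab x m <+: rdb φ lab x n := by
  rw [List.prefix_iff_eq_take, rdb_length]
  apply List.ext_getElem
  · simp [rdb_length, h]
  · intro i h1 h2
    rw [List.getElem_take, rdb_getElem, rdb_getElem]

theorem symm_iterate_cancel (y : X) (i j : ℕ) (h : i ≤ j) :
    φ.symm^[i] (φ^[j] y) = φ^[j - i] y := by
  obtain ⟨k, rfl⟩ := Nat.exists_eq_add_of_le h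
  rw [Function.iterate_add_apply, Nat.add_sub_cancel_left]
  exact (Function.LeftInverse.iterate φ.symm_apply_apply i) _

theorem rdb_eq (y : X) (n : ℕ) : rdb φ lab (φ^[n] y) (n + 1) = FreeGroup.invRev (rd φ lab y (n + 1)) := by
  apply List.ext_getElem
  · simp [rd_length, rdb_length]
  · intro i h1 h2
    rw [rdb_length] at h1
    simp only [FreeGroup.invRev, List.getElem_reverse, List.getElem_map, rd_getElem, rdb_getElem,
      List.length_map, rd_length]
    rw [symm_iterate_cancel _ _ _ (by omega)]
    rfl

end read

/-- the data of a minimal map together with the small cancellation hypotheses -/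
structure MinMap {β : Type*} {X : Type} [Fintype X] (W : Set (List (β × Bool)))
    (inv φ : Equiv.Perm X) (lab : X → β × Bool) (o : List X) (fs : List (List X)) : Prop where
  map : IsMap inv φ lab (o :: fs)
  rel : ∀ f ∈ fs, f.map lab ∈ W
  wrot : ∀ w ∈ W, ∀ k, w.rotate k ∈ W
  winv : ∀ w ∈ W, FreeGroup.invRev w ∈ W
  wred : ∀ w ∈ W, FreeGroup.IsReduced w
  wne : ∀ w ∈ W, w ≠ []
  wsc : ∀ r₁ ∈ W, ∀ r₂ ∈ W, r₁ ≠ r₂ → ∀ p, p ≠ [] → p <+: r₁ → p <+: r₂ → 6 * p.length < r₁.length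
  cne : o ≠ []
  cred : ∀ k, FreeGroup.IsReduced ((o.map lab).rotate k)
  cmaj : ∀ v, v <:+: o.map lab → ∀ r ∈ W, v <:+: r → 2 * v.length ≤ r.length
  minim : ∀ rs, (∀ w ∈ rs, w ∈ W) → HasMap (o.map lab :: rs) → fs.length ≤ rs.length

namespace MinMap
variable {β : Type*} {X : Type} [Fintype X] [DecidableEq X] {W : Set (List (β × Bool))}
    {inv φ : Equiv.Perm X} {lab : X → β × Bool} {o : List X} {fs : List (List X)}

theorem nodup_face (h : MinMap W inv φ lab o fs) {f : List X} (hf : f ∈ o :: fs) : f.Nodup :=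
  (List.nodup_flatten.mp h.map.nodup).1 f hf

theorem disj (h : MinMap W inv φ lab o fs) {f : List X} (hf : f ∈ fs) {x : X} (hx : x ∈ f) :
    x ∉ o := by
  have h1 := (List.nodup_flatten.mp h.map.nodup).2
  rw [List.pairwise_cons] at h1
  exact fun h2 => h1.1 f hf h2 hx

theorem exists_face (h : MinMap W inv φ lab o fs) {x : X} (hx : x ∉ o) :
    ∃ f ∈ fs, x ∈ f := by
  have := h.map.mem x
  rw [List.flatten_cons, List.mem_append, List.mem_flatten] at this
  tauto

theorem phi_mem (h : MinMap W inv φ lab o fs) {f : List X} (hf : f ∈ o :: fs) {x : X} :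
    φ x ∈ f ↔ x ∈ f := by
  have h1 := h.map.cyc f hf
  rw [← List.mem_rotate (n := 1), ← h1]
  simp

theorem iter_mem (h : MinMap W inv φ lab o fs) {f : List X} (hf : f ∈ o :: fs) {x : X} (j : ℕ) :
    φ^[j] x ∈ f ↔ x ∈ f := by
  induction j with
  | zero => rfl
  | succ j ih => rw [Function.iterate_succ_apply', h.phi_mem hf, ih]

theorem symm_mem (h : MinMap W inv φ lab o fs) {f : List X} (hf : f ∈ o :: fs) {x : X} :
    φ.symm x ∈ f ↔ x ∈ f := by
  rw [← h.phi_mem hf, Equiv.apply_symm_apply]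

theorem symm_iter_mem (h : MinMap W inv φ lab o fs) {f : List X} (hf : f ∈ o :: fs) {x : X} (j : ℕ) :
    φ.symm^[j] x ∈ f ↔ x ∈ f := by
  induction j with
  | zero => rfl
  | succ j ih => rw [Function.iterate_succ_apply', h.symm_mem hf, ih]

theorem rd_face (h : MinMap W inv φ lab o fs) {f : List X} (hf : f ∈ o :: fs) {x : X} (hx : x ∈ f) :
    ∃ k, rd φ lab x f.length = (f.map lab).rotate k := by
  obtain ⟨k, hk⟩ := (cyc_minimalPeriod (h.map.cyc f hf) (h.nodup_face hf) hx).2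
  exact ⟨k, by rw [rd, hk, List.map_rotate]⟩

theorem rd_mem (h : MinMap W inv φ lab o fs) {f : List X} (hf : f ∈ fs) {x : X} (hx : x ∈ f) :
    rd φ lab x f.length ∈ W := by
  obtain ⟨k, hk⟩ := h.rd_face (List.mem_cons_of_mem _ hf) hx
  rw [hk]; exact h.wrot _ (h.rel f hf) k

theorem period (h : MinMap W inv φ lab o fs) {f : List X} (hf : f ∈ o :: fs) {x : X} (hx : x ∈ f) :
    φ^[f.length] x = x := by
  have := (cyc_minimalPeriod (h.map.cyc f hf) (h.nodup_face hf) hx).1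
  rw [← this]
  exact Function.iterate_minimalPeriod

theorem period_ne (h : MinMap W inv φ lab o fs) {f : List X} (hf : f ∈ o :: fs) {x : X} (hx : x ∈ f)
    {j : ℕ} (h1 : 1 ≤ j) (h2 : j < f.length) : φ^[j] x ≠ x := by
  have := (cyc_minimalPeriod (h.map.cyc f hf) (h.nodup_face hf) hx).1
  rw [← this] at h2
  intro h3
  exact Function.not_isPeriodicPt_of_pos_of_lt_minimalPeriod (by omega) h2 h3

theorem rdb_face (h : MinMap W inv φ lab o fs) {f : List X} (hf : f ∈ o :: fs) {y : X} (hy : y ∈ f) :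
    rdb φ lab y f.length = FreeGroup.invRev (rd φ lab (φ y) f.length) := by
  have h1 := h.period hf hy
  have hpos : 0 < f.length := List.length_pos_of_mem hy
  obtain ⟨n, hn⟩ := Nat.exists_eq_succ_of_ne_zero hpos.ne'
  rw [hn, Nat.succ_eq_add_one, Function.iterate_succ_apply] at h1
  rw [hn, Nat.succ_eq_add_one, ← rdb_eq, h1]

theorem rdb_mem (h : MinMap W inv φ lab o fs) {f : List X} (hf : f ∈ fs) {y : X} (hy : y ∈ f) :
    rdb φ lab y f.length ∈ W := by
  have hf' := List.mem_cons_of_mem o hf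
  rw [h.rdb_face hf' hy]
  exact h.winv _ (h.rd_mem hf ((h.phi_mem hf').mpr hy))

/-- no cancellation along faces -/
theorem nocancel (h : MinMap W inv φ lab o fs) (x : X) : lab (φ x) ≠ flp (lab x) := by
  obtain ⟨f, hf, hx⟩ := List.mem_flatten.mp (h.map.mem x)
  have hred : FreeGroup.IsReduced (rd φ lab x f.length) := by
    rcases List.mem_cons.mp hf with rfl | hf'
    · obtain ⟨k, hk⟩ := h.rd_face hf hx
      rw [hk]; exact h.cred k
    · exact h.wred _ (h.rd_mem hf' hx)
  have hper := h.period hf hx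
  have hpos : 0 < f.length := List.length_pos_of_mem hx
  obtain ⟨n, hn⟩ := Nat.exists_eq_succ_of_ne_zero hpos.ne'
  rw [hn] at hred hper
  cases n with
  | zero =>
    have : φ x = x := hper
    rw [this]; exact (flp_ne _).symm
  | succ n =>
    simp only [rd, List.iterate, List.map_cons] at hred
    have h1 := (FreeGroup.isReduced_cons_cons.mp hred).1
    intro h2
    rw [h2] at h1
    simp [flp] at h1

theorem sigma_ne (h : MinMap W inv φ lab o fs) (x : X) : φ (inv x) ≠ x := by
  intro h1
  have := h.nocancel (inv x)
  rw [h1, h.map.lab_inv, flp_flp] at this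
  exact this rfl

/-- reducedness of a minimal map -/
theorem reduced (h : MinMap W inv φ lab o fs) {f g : List X} (hf : f ∈ fs) (hg : g ∈ fs) {x : X}
    (hx : x ∈ f) (hy : inv x ∈ g) : rd φ lab x f.length ≠ rdb φ lab (inv x) g.length := by
  classical
  intro heq
  have hf' := List.mem_cons_of_mem o hf
  have hg' := List.mem_cons_of_mem o hg
  by_cases hfg : f = g
  · subst hfg
    obtain ⟨k, hk⟩ := (cyc_minimalPeriod (h.map.cyc f hf') (h.nodup_face hf') hx).2
    have h1 : inv x ∈ List.iterate φ x f.length := by rw [hk]; simpa using hy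
    obtain ⟨j, hj, hjx⟩ := List.getElem_of_mem h1
    rw [List.length_iterate] at hj
    rw [List.getElem_iterate] at hjx
    have key : ∀ i, i ≤ j → lab (φ^[i] x) = flp (lab (φ^[j - i] x)) := by
      intro i hi
      have h2 : (rd φ lab x f.length)[i]'(by rw [rd_length]; omega) =
        (rdb φ lab (inv x) f.length)[i]'(by rw [rdb_length]; omega) := by simp only [heq]
      rw [rd_getElem, rdb_getElem, ← hjx, symm_iterate_cancel _ _ _ hi] at h2
      exact h2
    rcases Nat.even_or_odd' j with ⟨i, hi | hi⟩
    · have h2 := key i (by omega)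
      rw [show j - i = i by omega] at h2
      exact flp_ne _ h2.symm
    · have h2 := key i (by omega)
      rw [show j - i = i + 1 by omega, Function.iterate_succ_apply'] at h2
      apply h.nocancel (φ^[i] x)
      rw [h2, flp_flp]
  · obtain ⟨l, hl⟩ : ∃ l, fs.Perm (f :: g :: l) := by
      refine ⟨(fs.erase f).erase g, ?_⟩
      have h1 := List.perm_cons_erase hf
      have h2 : g ∈ fs.erase f := (List.mem_erase_of_ne (Ne.symm hfg)).mpr hg
      exact h1.trans ((List.perm_cons_erase h2).cons f)
    have hm := h.map.perm (fs' := f :: g :: o :: l) (by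
      refine (hl.cons o).trans ?_
      exact (List.Perm.swap _ _ _).trans ((List.Perm.swap _ _ _).cons f))
    obtain ⟨k, hk⟩ := (cyc_minimalPeriod (h.map.cyc f hf') (h.nodup_face hf') hx).2
    obtain ⟨k', hk'⟩ := (cyc_minimalPeriod (h.map.cyc g hg') (h.nodup_face hg')
      ((h.phi_mem hg').mpr hy)).2
    have hm1 := ((hm.rotate k).perm (List.Perm.swap _ _ _)).rotate k'
    have hm2 := hm1.perm (List.Perm.swap _ _ _)
    rw [← hk, ← hk'] at hm2
    rw [h.rdb_face hg' hy] at heq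
    have hlf : ∃ n, f.length = n + 1 :=
      Nat.exists_eq_succ_of_ne_zero (List.length_pos_of_mem hx).ne'
    have hlg : ∃ n, g.length = n + 1 :=
      Nat.exists_eq_succ_of_ne_zero (List.length_pos_of_mem hy).ne'
    obtain ⟨n, hn⟩ := hlf
    obtain ⟨n', hn'⟩ := hlg
    rw [hn, hn'] at hm2 heq
    rw [List.iterate, List.iterate] at hm2
    have hm3 := hm2.merge (Or.inl (pstep_mk (φ * inv) x).symm)
    have hM : HasMap ((rd φ lab x (n + 1) ++ rd φ lab (φ (inv x)) (n' + 1)) ::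
        o.map lab :: l.map (List.map lab)) := by
      refine ⟨X, inferInstance, inferInstance, _, _, lab, _, hm3, ?_⟩
      rw [List.map_cons, List.map_append]
      rfl
    rw [heq] at hM
    have hM2 := hM.red (w' := []) (by
      have := FreeGroup.reduce_invRev_left_cancel (L := rd φ lab (φ (inv x)) (n' + 1))
      rw [← this]
      exact FreeGroup.reduce.red)
    have hM3 := hasMap_nil_cons.mp hM2
    have := h.minim _ (by
      intro w hw
      obtain ⟨e, he, rfl⟩ := List.mem_map.mp hw
      exact h.rel e (hl.mem_iff.mpr (by simp [he]))) hM3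
    rw [hl.length_eq] at this
    simp at this

/-- the follow lemma -/
theorem follow (h : MinMap W inv φ lab o fs) {x : X}
    (hx : φ (inv (φ (inv (φ x)))) = φ x) : φ (inv (φ x)) = inv x := by
  have h1 := φ.injective hx
  rw [← h1, h.map.inv_inv, h1]

theorem follow_iter (h : MinMap W inv φ lab o fs) {x : X} (m : ℕ)
    (hx : ∀ j, 1 ≤ j → j < m → φ (inv (φ (inv (φ^[j] x)))) = φ^[j] x) :
    ∀ j < m, inv (φ^[j] x) = φ.symm^[j] (inv x) := by
  intro j
  induction j with
  | zero => intro _; rfl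
  | succ j ih =>
    intro hj
    have h1 := hx (j + 1) (by omega) hj
    rw [Function.iterate_succ_apply'] at h1
    have h2 := h.follow h1
    rw [Function.iterate_succ_apply', Function.iterate_succ_apply', ← ih (by omega), ← h2,
      Equiv.symm_apply_apply]

theorem follow_rd (h : MinMap W inv φ lab o fs) {x : X} (m : ℕ)
    (hx : ∀ j, 1 ≤ j → j < m → φ (inv (φ (inv (φ^[j] x)))) = φ^[j] x) :
    rd φ lab x m = rdb φ lab (inv x) m := by
  apply List.ext_getElem
  · simp [rd_length, rdb_length]
  · intro i h1 h2
    rw [rd_length] at h1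
    rw [rd_getElem, rdb_getElem, ← h.follow_iter m hx i h1, h.map.lab_inv, flp_flp]

theorem int_bound (h : MinMap W inv φ lab o fs) {f : List X} (hf : f ∈ fs) {x : X}
    (hx : x ∈ f) (hy : inv x ∉ o) (m : ℕ) (hm : 1 ≤ m)
    (hess : ∀ j, 1 ≤ j → j < m → φ (inv (φ (inv (φ^[j] x)))) = φ^[j] x) :
    6 * m < f.length := by
  obtain ⟨g, hg, hyg⟩ := h.exists_face hy
  have hne := h.reduced hf hg hx hyg
  have hpf : 0 < f.length := List.length_pos_of_mem hx
  have hpg : 0 < g.length := List.length_pos_of_mem hyg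
  set k := min m (min f.length g.length) with hk
  have hk1 : 1 ≤ k := by omega
  have heq := h.follow_rd k (fun j h1 h2 => hess j h1 (by omega))
  have hp1 : rd φ lab x k <+: rd φ lab x f.length := rd_initial x (by omega)
  have hp2 : rd φ lab x k <+: rdb φ lab (inv x) g.length := by
    rw [heq]; exact rdb_initial _ (by omega)
  have hne0 : rd φ lab x k ≠ [] := by
    intro h0
    have := rd_length (φ := φ) (lab := lab) x k
    rw [h0] at this
    simp at this
    omega
  have b1 := h.wsc _ (h.rd_mem hf hx) _ (h.rdb_mem hg hyg) hne _ hne0 hp1 hp2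
  have b2 := h.wsc _ (h.rdb_mem hg hyg) _ (h.rd_mem hf hx) hne.symm _ hne0 hp2 hp1
  rw [rd_length, rd_length] at b1
  rw [rd_length, rdb_length] at b2
  omega

theorem ext_bound (h : MinMap W inv φ lab o fs) {f : List X} (hf : f ∈ fs) {x b : X}
    (hx : x ∈ f) (hy : inv x ∈ o) (hb : o.head? = some (φ (inv b))) (m : ℕ) (hm : 1 ≤ m)
    (hess : ∀ j, 1 ≤ j → j < m → φ (inv (φ (inv (φ^[j] x)))) = φ^[j] x)
    (hnb : ∀ j, 1 ≤ j → j < m → φ^[j] x ≠ b) :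
    2 * m ≤ f.length := by
  have hpf : 0 < f.length := List.length_pos_of_mem hx
  have ho : o ∈ o :: fs := List.mem_cons_self
  suffices H : ∀ k, 1 ≤ k → k ≤ m → k ≤ f.length → 2 * k ≤ f.length by
    by_cases hmf : m ≤ f.length
    · exact H m hm le_rfl hmf
    · have := H f.length hpf (by omega) le_rfl
      omega
  intro k hk1 hkm hkf
  have heq := h.follow_rd k (fun j h1 h2 => hess j h1 (by omega))
  obtain ⟨i, rfl⟩ : ∃ i, k = i + 1 := ⟨k - 1, by omega⟩
  set z := φ.symm^[i] (inv x) with hz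
  have hzo : z ∈ o := (h.symm_iter_mem ho i).mpr hy
  have hzy : ∀ j ≤ i, φ^[j] z = φ.symm^[i - j] (inv x) := by
    intro j hj
    obtain ⟨d, rfl⟩ := Nat.exists_eq_add_of_le hj
    rw [hz, Function.iterate_add_apply, Nat.add_sub_cancel_left]
    exact (Function.LeftInverse.iterate φ.apply_symm_apply j) _
  have hzi : φ^[i] z = inv x := by rw [hzy i le_rfl]; simp
  have hinf : List.iterate φ z (i + 1) <:+: o := by
    apply cyc_sub (h.map.cyc o ho) hb hzo
    intro j hj1 hj2 hj
    rw [hzy j (by omega)] at hj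
    have hfi := h.follow_iter m hess (i - j + 1) (by omega)
    rw [Function.iterate_succ_apply' (⇑φ.symm), hj, Equiv.symm_apply_apply] at hfi
    exact hnb (i - j + 1) (by omega) (by omega) (inv.injective hfi)
  have hv : rd φ lab z (i + 1) <:+: o.map lab := hinf.map lab
  have hv2 : rd φ lab z (i + 1) = FreeGroup.invRev (rd φ lab x (i + 1)) := by
    rw [heq, ← hzi, rdb_eq, FreeGroup.invRev_invRev]
  have hw := h.winv _ (h.rd_mem hf hx)
  have hinf2 : rd φ lab z (i + 1) <:+: FreeGroup.invRev (rd φ lab x f.length) := by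
    obtain ⟨t, ht⟩ := rd_initial (φ := φ) (lab := lab) x hkf
    rw [hv2, ← ht, FreeGroup.invRev_append]
    exact (List.suffix_append _ _).isInfix
  have := h.cmaj _ hv _ hw hinf2
  rwa [rd_length, FreeGroup.invRev_length, rd_length] at this

/-- every inner face has an essential dart -/
theorem exists_ess (h : MinMap W inv φ lab o fs) {f : List X} (hf : f ∈ fs) {b : X}
    (hb : o.head? = some (φ (inv b))) : ∃ x ∈ f, φ (inv (φ (inv x))) ≠ x := by
  by_contra hno
  push Not at hno
  have hf' := List.mem_cons_of_mem o hf
  have hne : f ≠ [] := by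
    intro h0
    exact h.wne _ (h.rel f hf) (by rw [h0]; rfl)
  have hpos : 0 < f.length := List.length_pos_iff.mpr hne
  obtain ⟨x, hx, hxb⟩ : ∃ x ∈ f, b ∈ f → x = b := by
    by_cases hbf : b ∈ f
    · exact ⟨b, hbf, fun _ => rfl⟩
    · obtain ⟨x, hx⟩ := List.exists_mem_of_ne_nil f hne
      exact ⟨x, hx, fun h => absurd h hbf⟩
  have hess : ∀ j, 1 ≤ j → j < f.length → φ (inv (φ (inv (φ^[j] x)))) = φ^[j] x :=
    fun j _ _ => hno _ ((h.iter_mem hf' j).mpr hx)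
  by_cases hy : inv x ∈ o
  · have := h.ext_bound hf hx hy hb f.length hpos hess (by
      intro j h1 h2 h3
      have hbf : b ∈ f := h3 ▸ (h.iter_mem hf' j).mpr hx
      have := h.period_ne hf' hx h1 h2
      rw [h3] at this
      exact this (hxb hbf).symm)
    omega
  · have := h.int_bound hf hx hy f.length hpos hess
    omega

end MinMap

namespace MinMap
variable {β : Type*} {X : Type} [Fintype X] [DecidableEq X] {W : Set (List (β × Bool))}
    {inv φ : Equiv.Perm X} {lab : X → β × Bool} {o : List X} {fs : List (List X)}

/-- the discharging weight of a dart -/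
def wt (inv φ : Equiv.Perm X) (o : List X) (x : X) : ℕ :=
  if x ∈ o ∨ φ (inv (φ (inv x))) = x then 0
  else if inv x ∈ o then (if inv (φ.symm x) ∈ o then 6 else 3)
  else (if inv (φ.symm x) ∈ o then 3 else 2)

theorem wt_le (x : X) : wt inv φ o x ≤ 6 := by
  unfold wt; split_ifs <;> omega

theorem wt_outer {x : X} (hx : x ∈ o) : wt inv φ o x = 0 := by simp [wt, hx]

theorem card_le_fiber (h : MinMap W inv φ lab o fs) {f : List X} (hf : f ∈ fs) {x : X}
    (hx : x ∈ f) {b : X} (hb : o.head? = some (φ (inv b))) (hbf : b ∉ f) (S : Finset X)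
    (hS : ∀ z ∈ S, ∃ d, z = φ^[d] x ∧
      ∀ j, 1 ≤ j → j < d + 1 → φ (inv (φ (inv (φ^[j] x)))) = φ^[j] x) :
    6 * S.card ≤ if inv x ∈ o then 3 * f.length else f.length - 1 := by
  have hf' := List.mem_cons_of_mem o hf
  split_ifs with hy
  · have hsub : S ⊆ (Finset.range (f.length / 2)).image (fun d => φ^[d] x) := by
      intro z hz
      obtain ⟨d, rfl, hd⟩ := hS z hz
      have := h.ext_bound hf hx hy hb (d + 1) (by omega) hd (by
        intro j _ _ hj
        exact hbf (hj ▸ (h.iter_mem hf' j).mpr hx))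
      exact Finset.mem_image.mpr ⟨d, Finset.mem_range.mpr (by omega), rfl⟩
    have h1 := (Finset.card_le_card hsub).trans Finset.card_image_le
    rw [Finset.card_range] at h1
    omega
  · have hsub : S ⊆ (Finset.range ((f.length - 1) / 6)).image (fun d => φ^[d] x) := by
      intro z hz
      obtain ⟨d, rfl, hd⟩ := hS z hz
      have := h.int_bound hf hx hy (d + 1) (by omega) hd
      exact Finset.mem_image.mpr ⟨d, Finset.mem_range.mpr (by omega), rfl⟩
    have h1 := (Finset.card_le_card hsub).trans Finset.card_image_le
    rw [Finset.card_range] at h1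
    omega

theorem exists_back (h : MinMap W inv φ lab o fs) {f : List X} (hf : f ∈ fs) {x z : X}
    (hx : x ∈ f) (hz : z ∈ f) : ∃ d, φ.symm^[d] z = x := by
  have hf' := List.mem_cons_of_mem o hf
  obtain ⟨k, hk⟩ := (cyc_minimalPeriod (h.map.cyc f hf') (h.nodup_face hf') hx).2
  have h1 : z ∈ List.iterate φ x f.length := by rw [hk]; simpa using hz
  obtain ⟨d, hd, hdx⟩ := List.getElem_of_mem h1
  rw [List.getElem_iterate] at hdx
  refine ⟨d, ?_⟩
  rw [← hdx, symm_iterate_cancel _ _ _ le_rfl]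
  simp

theorem arc_count (h : MinMap W inv φ lab o fs) {f : List X} (hf : f ∈ fs) {b : X}
    (hb : o.head? = some (φ (inv b))) (hbf : b ∉ f) :
    6 * f.length ≤
      (f.toFinset.filter (fun x => φ (inv (φ (inv x))) ≠ x ∧ inv x ∉ o)).card * (f.length - 1) +
      (f.toFinset.filter (fun x => φ (inv (φ (inv x))) ≠ x ∧ inv x ∈ o)).card * (3 * f.length) := by
  classical
  have hf' := List.mem_cons_of_mem o hf
  obtain ⟨x0, hx0, hx0e⟩ := h.exists_ess hf hb
  have hex : ∀ z ∈ f, ∃ d, φ (inv (φ (inv (φ.symm^[d] z)))) ≠ φ.symm^[d] z := by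
    intro z hz
    obtain ⟨d, hd⟩ := h.exists_back hf hx0 hz
    exact ⟨d, by rw [hd]; exact hx0e⟩
  let L : X → X := fun z => if hz : z ∈ f then φ.symm^[Nat.find (hex z hz)] z else z
  set T := f.toFinset.filter (fun x => φ (inv (φ (inv x))) ≠ x) with hT
  have hL : ∀ z ∈ f.toFinset, L z ∈ T := by
    intro z hz
    have hz' := List.mem_toFinset.mp hz
    simp only [L, dif_pos hz', hT, Finset.mem_filter, List.mem_toFinset]
    exact ⟨(h.symm_iter_mem hf' _).mpr hz', Nat.find_spec (hex z hz')⟩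
  have hcard := Finset.card_eq_sum_card_fiberwise (f := L) (s := f.toFinset) (t := T) hL
  rw [List.toFinset_card_of_nodup (h.nodup_face hf')] at hcard
  have hfib : ∀ x ∈ T, 6 * (f.toFinset.filter (fun z => L z = x)).card ≤
      if inv x ∈ o then 3 * f.length else f.length - 1 := by
    intro x hxT
    have hx : x ∈ f := List.mem_toFinset.mp (Finset.mem_filter.mp hxT).1
    apply h.card_le_fiber hf hx hb hbf
    intro z hz
    obtain ⟨hz1, hz2⟩ := Finset.mem_filter.mp hz
    have hz' := List.mem_toFinset.mp hz1
    simp only [L, dif_pos hz'] at hz2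
    refine ⟨Nat.find (hex z hz'), ?_, ?_⟩
    · rw [← hz2]
      exact ((Function.LeftInverse.iterate φ.apply_symm_apply _) z).symm
    · intro j h1 h2
      set d := Nat.find (hex z hz') with hd
      have h3 := Nat.find_min (hex z hz') (m := d - j) (by omega)
      have h4 : φ^[j] x = φ.symm^[d - j] z := by
        rw [← hz2]
        obtain ⟨k, hk⟩ := Nat.exists_eq_add_of_le (show j ≤ d by omega)
        rw [hk, Function.iterate_add_apply, Nat.add_sub_cancel_left]
        exact (Function.LeftInverse.iterate φ.apply_symm_apply j) _
      rw [h4]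
      exact not_not.mp h3
  calc 6 * f.length = ∑ x ∈ T, 6 * (f.toFinset.filter (fun z => L z = x)).card := by
        rw [hcard, Finset.mul_sum]
    _ ≤ ∑ x ∈ T, if inv x ∈ o then 3 * f.length else f.length - 1 := Finset.sum_le_sum hfib
    _ = _ := by
        rw [Finset.sum_ite, Finset.sum_const, Finset.sum_const, hT, Finset.filter_filter,
          Finset.filter_filter, smul_eq_mul, smul_eq_mul, add_comm]

theorem ess_shift (h : MinMap W inv φ lab o fs) {f : List X} (hf : f ∈ fs) :
    (f.toFinset.filter (fun x => φ (inv (φ (inv x))) ≠ x ∧ inv (φ.symm x) ∈ o)).card =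
    (f.toFinset.filter (fun x => φ (inv (φ (inv x))) ≠ x ∧ inv x ∈ o)).card := by
  have hf' := List.mem_cons_of_mem o hf
  have ho : o ∈ o :: fs := List.mem_cons_self
  have e1 : (f.toFinset.filter (fun x => inv (φ.symm x) ∈ o)).card =
      (f.toFinset.filter (fun x => inv x ∈ o)).card := by
    refine Finset.card_bij (fun x _ => φ.symm x) ?_ ?_ ?_
    · intro x hx
      simp only [Finset.mem_filter, List.mem_toFinset] at hx ⊢
      exact ⟨(h.symm_mem hf').mpr hx.1, hx.2⟩
    · intro x _ y _ hxy
      exact φ.symm.injective hxy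
    · intro y hy
      simp only [Finset.mem_filter, List.mem_toFinset] at hy
      refine ⟨φ y, ?_, φ.symm_apply_apply y⟩
      simp only [Finset.mem_filter, List.mem_toFinset, Equiv.symm_apply_apply]
      exact ⟨(h.phi_mem hf').mpr hy.1, hy.2⟩
  have e2 : ∀ x, φ (inv (φ (inv x))) = x → (inv (φ.symm x) ∈ o ↔ inv x ∈ o) := by
    intro x hx
    have : inv (φ.symm x) = φ (inv x) := by
      conv_lhs => rw [← hx]
      rw [Equiv.symm_apply_apply, h.map.inv_inv]
    rw [this, h.phi_mem ho]
  have e3 : (f.toFinset.filter (fun x => φ (inv (φ (inv x))) = x ∧ inv (φ.symm x) ∈ o)) =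
      (f.toFinset.filter (fun x => φ (inv (φ (inv x))) = x ∧ inv x ∈ o)) := by
    apply Finset.filter_congr
    intro x _
    constructor
    · rintro ⟨h1, h2⟩; exact ⟨h1, (e2 x h1).mp h2⟩
    · rintro ⟨h1, h2⟩; exact ⟨h1, (e2 x h1).mpr h2⟩
  have s1 := Finset.card_filter_add_card_filter_not
    (s := f.toFinset.filter (fun x => inv (φ.symm x) ∈ o)) (fun x => φ (inv (φ (inv x))) = x)
  have s2 := Finset.card_filter_add_card_filter_not
    (s := f.toFinset.filter (fun x => inv x ∈ o)) (fun x => φ (inv (φ (inv x))) = x)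
  simp only [Finset.filter_filter] at s1 s2
  simp only [and_comm] at s1 s2 e3 ⊢
  rw [e3] at s1
  simp only [ne_eq] at *
  omega

theorem face_weight_pos (h : MinMap W inv φ lab o fs) {f : List X} (hf : f ∈ fs) {b : X}
    (hb : o.head? = some (φ (inv b))) : 1 ≤ ∑ x ∈ f.toFinset, wt inv φ o x := by
  obtain ⟨x, hx, hxe⟩ := h.exists_ess hf hb
  have h1 : 1 ≤ wt inv φ o x := by
    have := h.disj hf hx
    unfold wt
    rw [if_neg (by tauto)]
    split_ifs <;> omega
  exact h1.trans (Finset.single_le_sum (f := wt inv φ o) (fun _ _ => Nat.zero_le _)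
    (List.mem_toFinset.mpr hx))

theorem face_weight (h : MinMap W inv φ lab o fs) {f : List X} (hf : f ∈ fs) {b : X}
    (hb : o.head? = some (φ (inv b))) (hbf : b ∉ f) :
    12 ≤ ∑ x ∈ f.toFinset, wt inv φ o x := by
  have hn : 0 < f.length := by
    obtain ⟨x, hx, _⟩ := h.exists_ess hf hb
    exact List.length_pos_of_mem hx
  have harc := h.arc_count hf hb hbf
  have hsh := h.ess_shift hf
  set A := f.toFinset.filter (fun x => φ (inv (φ (inv x))) ≠ x ∧ inv x ∉ o) with hA
  set B := f.toFinset.filter (fun x => φ (inv (φ (inv x))) ≠ x ∧ inv x ∈ o) with hB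
  set C := f.toFinset.filter (fun x => φ (inv (φ (inv x))) ≠ x ∧ inv (φ.symm x) ∈ o) with hC
  have b1 : 2 * A.card + 3 * B.card + C.card ≤ ∑ x ∈ f.toFinset, wt inv φ o x := by
    rw [hA, hB, hC, Finset.card_filter, Finset.card_filter, Finset.card_filter,
      Finset.mul_sum, Finset.mul_sum, ← Finset.sum_add_distrib, ← Finset.sum_add_distrib]
    apply Finset.sum_le_sum
    intro x hx
    have hxo := h.disj hf (List.mem_toFinset.mp hx)
    unfold wt
    by_cases h1 : φ (inv (φ (inv x))) = x <;> by_cases h2 : inv x ∈ o <;>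
      by_cases h3 : inv (φ.symm x) ∈ o <;> simp [h1, h2, h3, hxo]
  have b2 : 3 * B.card + 3 * C.card ≤ ∑ x ∈ f.toFinset, wt inv φ o x := by
    rw [hB, hC, Finset.card_filter, Finset.card_filter,
      Finset.mul_sum, Finset.mul_sum, ← Finset.sum_add_distrib]
    apply Finset.sum_le_sum
    intro x hx
    have hxo := h.disj hf (List.mem_toFinset.mp hx)
    unfold wt
    by_cases h1 : φ (inv (φ (inv x))) = x <;> by_cases h2 : inv x ∈ o <;>
      by_cases h3 : inv (φ.symm x) ∈ o <;> simp [h1, h2, h3, hxo]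
  rw [hsh] at b1 b2
  by_cases hB2 : 2 ≤ B.card
  · omega
  obtain ⟨n, hn'⟩ : ∃ n, f.length = n + 1 := ⟨f.length - 1, by omega⟩
  rw [hn', Nat.add_sub_cancel] at harc
  by_contra hlt
  have hB1 : B.card = 0 ∨ B.card = 1 := by omega
  rcases hB1 with hB1 | hB1
  · rw [hB1] at harc b1
    have : A.card ≤ 5 := by omega
    have := Nat.mul_le_mul_right n this
    omega
  · rw [hB1] at harc b1
    have : A.card ≤ 3 := by omega
    have := Nat.mul_le_mul_right n this
    omega

theorem sum_faces (hnd : fs.flatten.Nodup) (F : X → ℕ) :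
    ∑ x ∈ fs.flatten.toFinset, F x = (fs.map (fun f => ∑ x ∈ f.toFinset, F x)).sum := by
  induction fs with
  | nil => simp
  | cons f fs ih =>
    rw [List.flatten_cons] at hnd
    have h1 := List.nodup_append'.mp hnd
    rw [List.flatten_cons, List.toFinset_append, Finset.sum_union, ih h1.2.1]
    · simp
    · rw [List.disjoint_toFinset_iff_disjoint]; exact h1.2.2

theorem sum_bound {F : List X → ℕ} (b : X) (hnd : fs.flatten.Nodup)
    (h1 : ∀ f ∈ fs, 1 ≤ F f) (h2 : ∀ f ∈ fs, b ∉ f → 12 ≤ F f) :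
    12 * fs.length ≤ (fs.map F).sum + 11 := by
  have key : ∀ gs : List (List X), (∀ f ∈ gs, 1 ≤ F f) → (∀ f ∈ gs, b ∉ f → 12 ≤ F f) →
      12 * gs.length ≤ (gs.map F).sum + 11 * gs.flatten.count b := by
    intro gs
    induction gs with
    | nil => simp
    | cons g gs ih =>
      intro g1 g2
      have i1 := ih (fun f hf => g1 f (by simp [hf])) (fun f hf => g2 f (by simp [hf]))
      have i2 := g1 g (by simp)
      have i3 := g2 g (by simp)
      rw [List.flatten_cons, List.count_append, List.map_cons, List.sum_cons, List.length_cons]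
      by_cases hbg : b ∈ g
      · have := List.count_pos_iff.mpr hbg
        omega
      · have := i3 hbg
        omega
  have := key fs h1 h2
  have := List.nodup_iff_count_le_one.mp hnd b
  omega

theorem orbit_bound (h : MinMap W inv φ lab o fs) (S : Finset X) (x : X)
    (hS : ∀ y, Quot.mk (pstep (φ * inv)) y = Quot.mk (pstep (φ * inv)) x → y ∈ S) :
    12 ≤ ∑ y ∈ S, (6 - wt inv φ o y) := by
  have ho : o ∈ o :: fs := List.mem_cons_self
  set F : X → ℕ := fun y => 6 - wt inv φ o y with hF
  have two : ∀ a c, a ∈ S → c ∈ S → a ≠ c → F a + F c ≤ ∑ y ∈ S, F y := by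
    intro a c ha hc hac
    rw [← Finset.sum_pair hac]
    apply Finset.sum_le_sum_of_subset
    intro y hy
    simp at hy
    rcases hy with rfl | rfl <;> assumption
  have three : ∀ a c d, a ∈ S → c ∈ S → d ∈ S → a ≠ c → a ≠ d → c ≠ d →
      F a + (F c + F d) ≤ ∑ y ∈ S, F y := by
    intro a c d ha hc hd hac had hcd
    rw [← Finset.sum_pair hcd, ← Finset.sum_insert (by simp [hac, had])]
    apply Finset.sum_le_sum_of_subset
    intro y hy
    simp at hy
    rcases hy with rfl | rfl | rfl <;> assumption
  have hout : ∀ y, y ∈ o → F y = 6 := by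
    intro y hy; simp [hF, wt_outer hy]
  have hnon : ∀ y, φ (inv (φ (inv y))) = y → F y = 6 := by
    intro y hy; simp [hF, wt, hy]
  have step : ∀ y, Quot.mk (pstep (φ * inv)) (φ (inv y)) = Quot.mk (pstep (φ * inv)) y :=
    fun y => pstep_mk (φ * inv) y
  have stepb : ∀ y, Quot.mk (pstep (φ * inv)) (inv (φ.symm y)) = Quot.mk (pstep (φ * inv)) y := by
    intro y
    have := step (inv (φ.symm y))
    rw [h.map.inv_inv, Equiv.apply_symm_apply] at this
    exact this.symm
  have sb : ∀ y, φ (inv (inv (φ.symm y))) = y := by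
    intro y; rw [h.map.inv_inv, Equiv.apply_symm_apply]
  have hsn := h.sigma_ne
  by_cases hA : ∃ y, Quot.mk (pstep (φ * inv)) y = Quot.mk (pstep (φ * inv)) x ∧
      φ (inv (φ (inv y))) = y
  · obtain ⟨y, hy, hye⟩ := hA
    have t := two y (φ (inv y)) (hS _ hy) (hS _ ((step y).trans hy)) (hsn y).symm
    rw [hnon y hye, hnon (φ (inv y)) (by rw [hye])] at t
    exact t
  push Not at hA
  by_cases hB : ∃ y, Quot.mk (pstep (φ * inv)) y = Quot.mk (pstep (φ * inv)) x ∧ y ∈ o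
  · obtain ⟨y, hy, hyo⟩ := hB
    by_cases hC : ∃ z, Quot.mk (pstep (φ * inv)) z = Quot.mk (pstep (φ * inv)) x ∧ z ∈ o ∧ z ≠ y
    · obtain ⟨z, hz, hzo, hzy⟩ := hC
      have t := two z y (hS _ hz) (hS _ hy) hzy
      rw [hout z hzo, hout y hyo] at t
      exact t
    · push Not at hC
      have e1 : Quot.mk (pstep (φ * inv)) (φ (inv y)) = Quot.mk (pstep (φ * inv)) x :=
        (step y).trans hy
      have e2 : Quot.mk (pstep (φ * inv)) (inv (φ.symm y)) = Quot.mk (pstep (φ * inv)) x :=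
        (stepb y).trans hy
      have n1 : φ (inv y) ≠ y := hsn y
      have n2 : inv (φ.symm y) ≠ y := by
        intro h0
        have := sb y
        rw [h0] at this
        exact hsn y this
      have n3 : φ (inv y) ≠ inv (φ.symm y) := by
        intro h0
        have := sb y
        rw [← h0] at this
        exact hA y hy this
      have t := three y (φ (inv y)) (inv (φ.symm y)) (hS _ hy) (hS _ e1) (hS _ e2)
        n1.symm n2.symm n3
      have o1 : φ (inv y) ∉ o := fun h0 => n1 (hC _ e1 h0)
      have o2 : inv (φ.symm y) ∉ o := fun h0 => n2 (hC _ e2 h0)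
      have f1 : 3 ≤ F (φ (inv y)) := by
        have : inv (φ (inv y)) ∉ o := by
          intro h0
          have h3 := (h.phi_mem ho).mpr h0
          exact hA y hy (hC _ ((step _).trans e1) h3)
        have hw : wt inv φ o (φ (inv y)) ≤ 3 := by
          unfold wt
          rw [if_neg this]
          split_ifs <;> omega
        simp only [hF]; omega
      have f2 : 3 ≤ F (inv (φ.symm y)) := by
        have : inv (φ.symm (inv (φ.symm y))) ∉ o := by
          intro h0
          have h3 := hC _ ((stepb _).trans e2) h0
          have h4 := sb (inv (φ.symm y))
          rw [h3] at h4
          exact n3 h4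
        have hw : wt inv φ o (inv (φ.symm y)) ≤ 3 := by
          unfold wt
          rw [if_neg this]
          split_ifs <;> omega
        simp only [hF]; omega
      rw [hout y hyo] at t
      refine le_trans ?_ t
      omega
  · push Not at hB
    have four : ∀ y, Quot.mk (pstep (φ * inv)) y = Quot.mk (pstep (φ * inv)) x → 4 ≤ F y := by
      intro y hy
      have a1 : inv y ∉ o := fun h0 => hB _ ((step y).trans hy) ((h.phi_mem ho).mpr h0)
      have a2 : inv (φ.symm y) ∉ o := hB _ ((stepb y).trans hy)
      have hw : wt inv φ o y ≤ 2 := by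
        unfold wt
        rw [if_neg a1, if_neg a2]
        split_ifs <;> omega
      simp only [hF]; omega
    have e1 := step x
    have e2 := (step (φ (inv x))).trans e1
    have t := three x (φ (inv x)) (φ (inv (φ (inv x)))) (hS _ rfl) (hS _ e1) (hS _ e2)
      (hsn x).symm (hA x rfl).symm (hsn _).symm
    have := four _ rfl
    have := four _ e1
    have := four _ e2
    refine le_trans ?_ t
    omega

theorem vertex_bound (h : MinMap W inv φ lab o fs) :
    12 * ncyc (φ * inv) ≤ ∑ x, (6 - wt inv φ o x) := by
  classical
  have : Fintype (Quot (pstep (φ * inv))) := Fintype.ofFinite _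
  rw [← Finset.sum_fiberwise (g := fun x => Quot.mk (pstep (φ * inv)) x)]
  have h1 : ∀ q : Quot (pstep (φ * inv)),
      12 ≤ ∑ x with Quot.mk (pstep (φ * inv)) x = q, (6 - wt inv φ o x) := by
    rintro ⟨x⟩
    apply h.orbit_bound _ x
    intro y hy
    simpa using hy
  have h2 := Finset.card_nsmul_le_sum Finset.univ
    (fun q : Quot (pstep (φ * inv)) =>
      ∑ x with Quot.mk (pstep (φ * inv)) x = q, (6 - wt inv φ o x)) 12 (fun q _ => h1 q)
  rw [Finset.card_univ, smul_eq_mul, ← Nat.card_eq_fintype_card, mul_comm] at h2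
  exact h2

theorem absurd_map (h : MinMap W inv φ lab o fs) : False := by
  obtain ⟨z, t, hzt⟩ := List.exists_cons_of_ne_nil h.cne
  set b := inv (φ.symm z) with hbdef
  have hb : o.head? = some (φ (inv b)) := by
    rw [hbdef, h.map.inv_inv, Equiv.apply_symm_apply, hzt]; rfl
  have hnd := h.map.nodup
  have hnd2 := (List.nodup_append'.mp (by rw [List.flatten_cons] at hnd; exact hnd)).2.1
  have v := h.vertex_bound
  have s : ∑ x, wt inv φ o x + ∑ x, (6 - wt inv φ o x) = 6 * Fintype.card X := by
    rw [← Finset.sum_add_distrib, Finset.sum_congr rfl (g := fun _ => 6)]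
    · simp [mul_comm]
    · intro x _
      have := wt_le (inv := inv) (φ := φ) (o := o) x
      omega
  have w : ∑ x, wt inv φ o x = (fs.map (fun f => ∑ x ∈ f.toFinset, wt inv φ o x)).sum := by
    rw [← sum_faces hnd2]
    symm
    apply Finset.sum_subset (Finset.subset_univ _)
    intro x _ hx
    apply wt_outer
    by_contra hxo
    obtain ⟨f, hf, hxf⟩ := h.exists_face hxo
    exact hx (List.mem_toFinset.mpr (List.mem_flatten.mpr ⟨f, hf, hxf⟩))
  have sb := sum_bound (fs := fs) (F := fun f => ∑ x ∈ f.toFinset, wt inv φ o x) b hnd2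
    (fun f hf => h.face_weight_pos hf hb) (fun f hf hbf => h.face_weight hf hb hbf)
  have e := h.map.euler
  have hc : 1 ≤ ncomp inv φ := by
    unfold ncomp
    have : Nonempty (Quot (cstep inv φ)) := ⟨Quot.mk _ z⟩
    exact Nat.card_pos
  have hnf : nface (o :: fs) ≤ fs.length + 1 := List.countP_le_length
  omega

end MinMap

/-- Let `⟨A ∣ R⟩` be a `C'(1/6)` presentation with cyclically reduced relators.
If `u ≠ 1` is majority-reduced — its reduced word contains no subword `v` which is a
subword of some `r ∈ R*` with `|v| > |r|/2` — then `u` does not lie in the normal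
closure of `R`, i.e. it represents a nontrivial element of `⟨A ∣ R⟩`. -/
theorem majority_reduced_nontrivial (R : Set (FreeGroup α))
    (hcyc : ∀ r ∈ R, IsCyclicallyReduced r.toWord)
    (hC : CPrimeSixth R) (u : FreeGroup α) (hu : u ≠ 1)
    (hmaj : ∀ v : List (α × Bool), v <:+: u.toWord →
      ∀ r ∈ symClosure R, v <:+: r.toWord → 2 * v.length ≤ r.toWord.length) :
    u ∉ Subgroup.normalClosure R := by
  classical
  intro hmem
  obtain ⟨c, hc1, hcn, hcu, hcr⟩ := exists_core u hu hmem
  have hex : ∃ n, ∃ rs, (∀ w ∈ rs, w ∈ relWords R) ∧ HasMap (c.toWord :: rs) ∧ rs.length = n := by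
    obtain ⟨rs, h1, h2⟩ := bounds_of_mem_normalClosure hcn
    exact ⟨_, rs, h1, h2, rfl⟩
  obtain ⟨rs, hrs, hm, hlen⟩ := Nat.find_spec hex
  have hmin : ∀ rs', (∀ w ∈ rs', w ∈ relWords R) → HasMap (c.toWord :: rs') →
      rs.length ≤ rs'.length := by
    intro rs' h1 h2
    rw [hlen]
    exact Nat.find_min' hex ⟨rs', h1, h2, rfl⟩
  obtain ⟨X, _, _, inv, φ, lab, fs, hmap, he⟩ := hm
  cases fs with
  | nil => simp at he
  | cons o fs =>
    simp only [List.map_cons, List.cons.injEq] at he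
    obtain ⟨ho, hfs⟩ := he
    have hM : MinMap (relWords R) inv φ lab o fs :=
      { map := hmap
        rel := fun f hf => hrs _ (by rw [← hfs]; exact List.mem_map_of_mem hf)
        wrot := fun w hw k => relWords_rotate hcyc hw k
        winv := fun w hw => relWords_inv hw
        wred := fun w hw => relWords_reduced hw
        wne := fun w hw => hw.1
        wsc := by
          rintro r₁ ⟨_, g₁, hg₁, rfl⟩ r₂ ⟨_, g₂, hg₂, rfl⟩ hne p hp h1 h2
          exact hC p ⟨hp, g₁, hg₁, g₂, hg₂, fun h => hne (by rw [h]), h1, h2⟩ g₁ hg₁ h1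
        cne := by
          rintro rfl
          exact hc1 (FreeGroup.toWord_eq_nil_iff.mp ho.symm)
        cred := by
          intro k
          rw [ho]; exact rotate_reduced hcr k
        cmaj := by
          rintro v hv r ⟨_, g, hg, rfl⟩ hvr
          rw [ho] at hv
          exact hmaj v (hv.trans hcu) g hg hvr
        minim := by
          intro rs' h1 h2
          rw [ho] at h2
          have := hmin rs' h1 h2
          rw [← hfs, List.length_map] at this
          exact this }
    exact hM.absurd_map
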